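/- arXiv:math/0106134 — 2 statements merged into one kernel-verified Lean document; each statement's English description precedes it below -/
import Mathlib

section
/- Let k ≥ 1, let q¹, q² be Schwartz functions on ℂ, and let T be a Schwartz function on ℂ. Define S_k^{12}(z) = π^{−2k} ∫_{ℂ^{2k+1}} a¹(−x₀ + x₁ − x₂ + ⋯ + x_{2k−1} − x_{2k}, z) · q¹(x₀) q²(x₁) q¹(x₂) ⋯ q²(x_{2k−1}) q¹(x_{2k}) / ( (x̄₀ − x̄₁)(x₁ − x₂)(x̄₂ − x̄₃) ⋯ (x̄_{2k−2} − x̄_{2k−1})(x_{2k−1} − x_{2k}) ) dμ(x₀, …, x_{2k}), where a¹(x,z) = exp(i x z̄ + i x̄ z). Then ∫_ℂ T(z) S_k^{12}(z) dμ(z) = π^{−2k} ∫_{ℂ^{2k+1}} T̂( 2(x₀ − x₁ + x₂ − ⋯ − x_{2k−1} + x_{2k}) ) · q¹(x₀) q²(x₁) ⋯ q²(x_{2k−1}) q¹(x_{2k}) / ( (x̄₀ − x̄₁)(x₁ − x₂) ⋯ (x̄_{2k−2} − x̄_{2k−1})(x_{2k−1} − x_{2k}) ) dμ(x₀, …, x_{2k}),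 where T̂(ζ) = ∫_ℂ T(x) exp(−i(x¹ζ¹ + x²ζ²)) dμ(x), and both iterated integrals converge absolutely. -/
open MeasureTheory

/-- The unimodular character `a¹(x,z) = exp(i x z̄ + i x̄ z)`. -/
noncomputable def a1 (x z : ℂ) : ℂ :=
  Complex.exp (Complex.I * x * (starRingEnd ℂ z) + Complex.I * (starRingEnd ℂ x) * z)

/-- The alternating sum `x₀ − x₁ + x₂ − ⋯ + x_{2k}`. -/
noncomputable def altSum {n : ℕ} (x : Fin n → ℂ) : ℂ :=
  ∑ i : Fin n, (-1 : ℂ) ^ (i : ℕ) * x i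

/-- The alternating product of potentials `q¹(x₀) q²(x₁) q¹(x₂) ⋯ q²(x_{2k−1}) q¹(x_{2k})`. -/
noncomputable def altProd (q1 q2 : ℂ → ℂ) {n : ℕ} (x : Fin n → ℂ) : ℂ :=
  ∏ i : Fin n, (if (i : ℕ) % 2 = 0 then q1 else q2) (x i)

/-- The alternating product of Cauchy kernels
`(x̄₀ − x̄₁)(x₁ − x₂)(x̄₂ − x̄₃) ⋯ (x̄_{2k−2} − x̄_{2k−1})(x_{2k−1} − x_{2k})`. -/
noncomputable def cauchyDen {n : ℕ} (x : Fin (n + 1) → ℂ) : ℂ :=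
  ∏ j : Fin n,
    if (j : ℕ) % 2 = 0 then
      (starRingEnd ℂ) (x j.castSucc) - (starRingEnd ℂ) (x j.succ)
    else x j.castSucc - x j.succ

/-- The `k`-th multilinear term (upper-right entry) of the scattering transform. -/
noncomputable def Sk12 (q1 q2 : ℂ → ℂ) (k : ℕ) (z : ℂ) : ℂ :=
  ((Real.pi : ℂ) ^ (2 * k))⁻¹ *
    ∫ x : Fin (2 * k + 1) → ℂ, a1 (-altSum x) z * altProd q1 q2 x / cauchyDen x

/-- The Fourier transform `T̂(ζ) = ∫_ℂ T(x) exp(−i(x¹ζ¹ + x²ζ²)) dμ(x)`. -/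
noncomputable def fourierInt (T : ℂ → ℂ) (ζ : ℂ) : ℂ :=
  ∫ x : ℂ, T x * Complex.exp (-Complex.I * ((x.re * ζ.re + x.im * ζ.im : ℝ) : ℂ))

open scoped ENNReal

/-- Convolving an integrable bounded density against the Cauchy kernel gives a bounded function. -/
lemma exists_lintegral_mul_enorm_inv_sub_le {G : ℂ → ℝ≥0∞} {M : ℝ≥0∞}
    (hM : M ≠ ∞) (hGM : ∀ y, G y ≤ M) (hGint : ∫⁻ y, G y ≠ ∞) :
    ∃ C : ℝ≥0∞, C ≠ ∞ ∧ ∀ x : ℂ, ∫⁻ y, G y * ‖(y - x)⁻¹‖ₑ ≤ C := by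
  have hball : IntegrableOn (fun y : ℂ => y⁻¹) (Metric.ball 0 1) := by
    refine integrableOn_ball_of_norm_le_rpow (C := 1) (α := 1) ?_ ?_ ?_ ?_
    · simp [Complex.finrank_real_complex]
    · simp [Complex.finrank_real_complex]
    · exact Filter.Eventually.of_forall fun x => by simp [Real.rpow_neg_one]
    · exact measurable_inv.aestronglyMeasurable
  set K : ℂ → ℝ≥0∞ := (Metric.ball (0 : ℂ) 1).indicator fun y => ‖y⁻¹‖ₑ with hK
  have hKm : Measurable K := (by fun_prop : Measurable fun y : ℂ => ‖y⁻¹‖ₑ).indicator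
    measurableSet_ball
  have hKint : ∫⁻ y, K y ≠ ∞ := by
    rw [hK, lintegral_indicator measurableSet_ball]
    exact hball.2.ne
  refine ⟨M * (∫⁻ y, K y) + ∫⁻ y, G y, by finiteness, fun x => ?_⟩
  calc ∫⁻ y, G y * ‖(y - x)⁻¹‖ₑ ≤ ∫⁻ y, (M * K (y - x) + G y) := by
        refine lintegral_mono fun y => ?_
        by_cases hy : y - x ∈ Metric.ball (0 : ℂ) 1
        · simp only [hK, Set.indicator_of_mem hy]
          exact le_add_right (mul_le_mul_left (hGM y) _)
        · refine le_add_left ?_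
          have h1 : ‖(y - x)⁻¹‖ₑ ≤ 1 := by
            rw [← ofReal_norm, ← ENNReal.ofReal_one]
            apply ENNReal.ofReal_le_ofReal
            rw [norm_inv]
            apply inv_le_one_of_one_le₀
            simpa using hy
          calc G y * ‖(y - x)⁻¹‖ₑ ≤ G y * 1 := by gcongr
            _ = G y := mul_one _
    _ = M * (∫⁻ y, K y) + ∫⁻ y, G y := by
        rw [lintegral_add_left (by fun_prop), lintegral_const_mul _ (by fun_prop),
          lintegral_sub_right_eq_self K x]

/-- Bound for a chain of Cauchy kernels, integrating out one endpoint at a time. -/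
lemma lintegral_prod_mul_prod_enorm_inv_sub_le {G : ℂ → ℝ≥0∞} (hG : Measurable G) {C : ℝ≥0∞}
    (hC : ∀ x : ℂ, ∫⁻ y, G y * ‖(y - x)⁻¹‖ₑ ≤ C) (n : ℕ) :
    ∫⁻ x : Fin (n + 1) → ℂ,
        (∏ i, G (x i)) * ∏ j : Fin n, ‖(x j.castSucc - x j.succ)⁻¹‖ₑ ≤ C ^ n * ∫⁻ y, G y := by
  induction n with
  | zero =>
    have h := (volume_preserving_funUnique (Fin 1) ℂ).lintegral_comp hG
    simp only [MeasurableEquiv.funUnique_apply] at h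
    simp only [Finset.univ_eq_empty, Finset.prod_empty, mul_one, pow_zero, one_mul]
    refine (Eq.trans ?_ h).le
    exact lintegral_congr fun x : Fin 1 → ℂ => Fin.prod_univ_one fun i => G (x i)
  | succ n ih =>
    rw [← (volume_preserving_piFinSuccAbove (fun _ : Fin (n + 2) => ℂ) 0).symm.lintegral_comp
      (by fun_prop)]
    rw [Measure.volume_eq_prod, lintegral_prod_symm' _ (by fun_prop)]
    have hsplit : ∀ (y : Fin (n + 1) → ℂ) (a : ℂ),
        (∏ i, G ((MeasurableEquiv.piFinSuccAbove (fun _ : Fin (n + 2) => ℂ) 0).symm (a, y) i)) *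
          ∏ j : Fin (n + 1),
            ‖((MeasurableEquiv.piFinSuccAbove (fun _ : Fin (n + 2) => ℂ) 0).symm (a, y) j.castSucc
              - (MeasurableEquiv.piFinSuccAbove (fun _ : Fin (n + 2) => ℂ) 0).symm (a, y)
                j.succ)⁻¹‖ₑ
        = (G a * ‖(a - y 0)⁻¹‖ₑ) *
          ((∏ i, G (y i)) * ∏ j : Fin n, ‖(y j.castSucc - y j.succ)⁻¹‖ₑ) := by
      intro y a
      have he : (MeasurableEquiv.piFinSuccAbove (fun _ : Fin (n + 2) => ℂ) 0).symm (a, y)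
          = Fin.cons a y := by
        simp [MeasurableEquiv.piFinSuccAbove_symm_apply, Fin.insertNthEquiv]
      rw [he, Fin.prod_univ_succ, Fin.prod_univ_succ (fun j : Fin (n + 1) =>
        ‖((Fin.cons a y : Fin (n + 2) → ℂ) j.castSucc - (Fin.cons a y : Fin (n + 2) → ℂ) j.succ)⁻¹‖ₑ)]
      simp only [Fin.cons_zero, Fin.cons_succ, Fin.castSucc_zero, ← Fin.succ_castSucc]
      ring
    simp_rw [hsplit]
    calc _ = ∫⁻ y : Fin (n + 1) → ℂ, (∫⁻ a, G a * ‖(a - y 0)⁻¹‖ₑ) *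
          ((∏ i, G (y i)) * ∏ j : Fin n, ‖(y j.castSucc - y j.succ)⁻¹‖ₑ) := by
          refine lintegral_congr fun y => ?_
          rw [lintegral_mul_const _ (by fun_prop)]
      _ ≤ ∫⁻ y : Fin (n + 1) → ℂ, C *
          ((∏ i, G (y i)) * ∏ j : Fin n, ‖(y j.castSucc - y j.succ)⁻¹‖ₑ) :=
          lintegral_mono fun y => mul_le_mul_left (hC (y 0)) _
      _ = C * ∫⁻ y : Fin (n + 1) → ℂ,
          ((∏ i, G (y i)) * ∏ j : Fin n, ‖(y j.castSucc - y j.succ)⁻¹‖ₑ) :=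
          lintegral_const_mul _ (by fun_prop)
      _ ≤ C * (C ^ n * ∫⁻ y, G y) := by gcongr
      _ = C ^ (n + 1) * ∫⁻ y, G y := by ring

lemma measurable_altSum {n : ℕ} : Measurable (altSum : (Fin n → ℂ) → ℂ) := by
  unfold altSum
  fun_prop

lemma measurable_altProd {q1 q2 : ℂ → ℂ} (h1 : Measurable q1) (h2 : Measurable q2) {n : ℕ} :
    Measurable (altProd q1 q2 : (Fin n → ℂ) → ℂ) := by
  unfold altProd
  refine Finset.measurable_prod _ fun i _ => ?_
  split_ifs <;> fun_prop

lemma measurable_cauchyDen {n : ℕ} : Measurable (cauchyDen : (Fin (n + 1) → ℂ) → ℂ) := by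
  unfold cauchyDen
  refine Finset.measurable_prod _ fun i _ => ?_
  have := Complex.continuous_conj.measurable
  split_ifs <;> fun_prop

lemma enorm_altProd_div_cauchyDen_le (q1 q2 : ℂ → ℂ) {n : ℕ} (x : Fin (n + 1) → ℂ) :
    ‖altProd q1 q2 x / cauchyDen x‖ₑ ≤ (∏ i, (‖q1 (x i)‖ₑ + ‖q2 (x i)‖ₑ)) *
      ∏ j : Fin n, ‖(x j.castSucc - x j.succ)⁻¹‖ₑ := by
  have hprod : ∀ {ι : Type} (s : Finset ι) (f : ι → ℂ), ‖∏ i ∈ s, f i‖ₑ = ∏ i ∈ s, ‖f i‖ₑ :=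
    fun s f => by
      simp only [← ofReal_norm, norm_prod]
      exact ENNReal.ofReal_prod_of_nonneg fun _ _ => norm_nonneg _
  rw [div_eq_mul_inv, enorm_mul, altProd, cauchyDen, ← Finset.prod_inv_distrib, hprod, hprod]
  refine mul_le_mul' (Finset.prod_le_prod' fun i _ => ?_) (Finset.prod_le_prod' fun j _ => ?_)
  · split_ifs
    · exact le_self_add
    · exact le_add_self
  · split_ifs
    · rw [← map_sub, ← map_inv₀, ← ofReal_norm, ← ofReal_norm, Complex.norm_conj]
    · exact le_rfl

lemma integrable_altProd_div_cauchyDen (q1 q2 : SchwartzMap ℂ ℂ) (n : ℕ) :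
    Integrable (fun x : Fin (n + 1) → ℂ => altProd q1 q2 x / cauchyDen x) := by
  have m1 : Measurable q1 := q1.continuous.measurable
  have m2 : Measurable q2 := q2.continuous.measurable
  set G : ℂ → ℝ≥0∞ := fun y => ‖q1 y‖ₑ + ‖q2 y‖ₑ with hGdef
  have hG : Measurable G := by fun_prop
  have hGint : ∫⁻ y, G y ≠ ∞ := by
    rw [hGdef, lintegral_add_left (by fun_prop)]
    exact ENNReal.add_ne_top.2 ⟨q1.integrable.2.ne, q2.integrable.2.ne⟩
  have hb : ∀ (q : SchwartzMap ℂ ℂ) (y : ℂ),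
      ‖q y‖ₑ ≤ ENNReal.ofReal (SchwartzMap.seminorm ℝ 0 0 q) := fun q y => by
    rw [← ofReal_norm]
    exact ENNReal.ofReal_le_ofReal (SchwartzMap.norm_le_seminorm ℝ q y)
  obtain ⟨C, hC, hCle⟩ := exists_lintegral_mul_enorm_inv_sub_le (by finiteness)
    (fun y => add_le_add (hb q1 y) (hb q2 y)) hGint
  refine ⟨((measurable_altProd m1 m2).div measurable_cauchyDen).aestronglyMeasurable, ?_⟩
  calc ∫⁻ x : Fin (n + 1) → ℂ, ‖altProd q1 q2 x / cauchyDen x‖ₑ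
      ≤ C ^ n * ∫⁻ y, G y := (lintegral_mono fun x =>
        enorm_altProd_div_cauchyDen_le q1 q2 x).trans
        (lintegral_prod_mul_prod_enorm_inv_sub_le hG hCle n)
    _ < ∞ := by finiteness

lemma a1_neg_eq_exp (s z : ℂ) :
    a1 (-s) z = Complex.exp
      (-Complex.I * ((z.re * (2 * s).re + z.im * (2 * s).im : ℝ) : ℂ)) := by
  rw [a1]
  congr 1
  apply Complex.ext
  · simp
  · simp
    ring

lemma norm_a1_neg (s z : ℂ) : ‖a1 (-s) z‖ = 1 := by
  rw [a1_neg_eq_exp, neg_mul, mul_comm, ← neg_mul, ← Complex.ofReal_neg]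
  exact Complex.norm_exp_ofReal_mul_I _

/-- Pairing the `k`-th scattering term against a Schwartz test function
and integrating in `z` first turns the character `a¹` into the Fourier transform of `T`:
`∫ T(z) S_k^{12}(z) dμ(z) = π^{−2k} ∫_{ℂ^{2k+1}} T̂(2(x₀−x₁+⋯+x_{2k})) ⋅ N/D dμ`,
and both iterated integrals converge absolutely. -/
theorem pairing_fubini (k : ℕ) (hk : 1 ≤ k) (q1 q2 T : SchwartzMap ℂ ℂ) :
    Integrable
      (fun p : ℂ × (Fin (2 * k + 1) → ℂ) =>
        T p.1 * (a1 (-altSum p.2) p.1 * altProd q1 q2 p.2 / cauchyDen p.2)) volume ∧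
    Integrable
      (fun x : Fin (2 * k + 1) → ℂ =>
        fourierInt T (2 * altSum x) * altProd q1 q2 x / cauchyDen x) volume ∧
    ∫ z : ℂ, T z * Sk12 q1 q2 k z
      = ((Real.pi : ℂ) ^ (2 * k))⁻¹ *
        ∫ x : Fin (2 * k + 1) → ℂ,
          fourierInt T (2 * altSum x) * altProd q1 q2 x / cauchyDen x := by
  have hF := integrable_altProd_div_cauchyDen q1 q2 (2 * k)
  have hint : Integrable
      (fun p : ℂ × (Fin (2 * k + 1) → ℂ) =>
        T p.1 * (a1 (-altSum p.2) p.1 * altProd q1 q2 p.2 / cauchyDen p.2))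
      ((volume : Measure ℂ).prod volume) := by
    have hs : Measurable (altSum : (Fin (2 * k + 1) → ℂ) → ℂ) := measurable_altSum
    have hconj := Complex.continuous_conj.measurable
    have ha : Measurable fun p : ℂ × (Fin (2 * k + 1) → ℂ) => a1 (-altSum p.2) p.1 := by
      unfold a1
      fun_prop
    refine ((T.integrable (μ := volume)).mul_prod hF).bdd_mul (c := 1) ha.aestronglyMeasurable
      (Filter.Eventually.of_forall fun p => (norm_a1_neg _ _).le) |>.congr
      (Filter.Eventually.of_forall fun p => ?_)
    simp only
    ring
  have hinner : ∀ x : Fin (2 * k + 1) → ℂ,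
      ∫ z : ℂ, T z * (a1 (-altSum x) z * altProd q1 q2 x / cauchyDen x)
        = fourierInt T (2 * altSum x) * altProd q1 q2 x / cauchyDen x := by
    intro x
    rw [fourierInt, mul_div_assoc, ← integral_mul_const]
    refine integral_congr_ae (Filter.Eventually.of_forall fun z => ?_)
    simp only [a1_neg_eq_exp]
    ring
  refine ⟨hint, ?_, ?_⟩
  · simpa only [hinner] using hint.integral_prod_right
  · simp_rw [← hinner, Sk12, mul_left_comm (T _)]
    rw [integral_const_mul]
    simp_rw [← integral_const_mul (T _)]
    rw [integral_integral_swap hint]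
end

section
/- Let M > 0. For every ε > 0 there exists a constant C_ε such that for every integer k ≥ 0 and all pairs of Schwartz potentials Q (entries q¹, q²) and Q̃ (entries q̃¹, q̃²) with ‖Q‖₂ ≤ M and ‖Q̃‖₂ ≤ M (where ‖Q‖₂² = ‖q¹‖₂² + ‖q²‖₂²), the k-th multilinear scattering terms satisfy ‖ S_k^{12}(Q) − S_k^{12}(Q̃) ‖_{L²(ℂ)} ≤ C_ε (2k+1) (1+ε)^{2k} M^{2k} ‖Q − Q̃‖₂, where ‖Q − Q̃‖₂² = ‖q¹ − q̃¹‖₂² + ‖q² − q̃²‖₂². -/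
open MeasureTheory

/-- The `L²` norm of the off-diagonal matrix potential with entries `f`, `g`:
`‖Q‖₂ = (‖q¹‖₂² + ‖q²‖₂²)^{1/2}`. -/
noncomputable def matrixL2Norm (f g : ℂ → ℂ) : ℝ :=
  Real.sqrt ((eLpNorm f 2 volume).toReal ^ 2 + (eLpNorm g 2 volume).toReal ^ 2)

section

open Set
open scoped ENNReal

/-- The Riesz kernel `|x - y|^(-(2 - 2s))` on the plane, with value `0` on the diagonal. -/
noncomputable def rieszKernel (s : ℝ) (x y : ℂ) : ℝ≥0∞ :=
  ENNReal.ofReal (‖x - y‖ ^ (-(2 - 2 * s)))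

theorem rieszKernel_comm (s : ℝ) (x y : ℂ) : rieszKernel s x y = rieszKernel s y x := by
  simp only [rieszKernel, norm_sub_rev]

theorem measurable_rieszKernel (s : ℝ) :
    Measurable (fun p : ℂ × ℂ => rieszKernel s p.1 p.2) := by
  unfold rieszKernel
  fun_prop

theorem lintegral_Ioi_ofReal_rpow {e t : ℝ} (he : 1 < e) (ht : 0 < t) :
    ∫⁻ u in Ioi t, ENNReal.ofReal (u ^ (-e)) = ENNReal.ofReal (t ^ (1 - e) / (e - 1)) := by
  rw [← ofReal_integral_eq_lintegral_ofReal]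
  · rw [integral_Ioi_rpow_of_lt (by linarith) ht]
    congr 1
    rw [show -e + 1 = -(e - 1) by ring, neg_div_neg_eq, show 1 - e = -(e-1) by ring]
  · exact integrableOn_Ioi_rpow_of_lt (by linarith) ht
  · filter_upwards [self_mem_ae_restrict measurableSet_Ioi] with u hu
    exact Real.rpow_nonneg (ht.trans hu).le _

theorem setLIntegral_rieszKernel_le {s : ℝ} (hs0 : 0 < s) (hs1 : s < 1) (B : Set ℂ) (x : ℂ) :
    ∫⁻ y in B, rieszKernel s x y ≤ ENNReal.ofReal (Real.pi ^ (1 - s) / s) * volume B ^ s := by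
  have hpi := Real.pi_pos
  have hc : 0 < Real.pi ^ (1 - s) / s := by positivity
  rcases eq_or_ne (volume B) 0 with h0 | h0
  · rw [Measure.restrict_eq_zero.2 h0]; simp
  rcases eq_or_ne (volume B) ∞ with hi | hi
  · rw [hi, ENNReal.top_rpow_of_pos hs0, ENNReal.mul_top (by simpa using hc)]
    exact le_top
  obtain ⟨b, hb, hbB⟩ : ∃ b : ℝ, 0 < b ∧ volume B = ENNReal.ofReal b :=
    ⟨(volume B).toReal, ENNReal.toReal_pos h0 hi, (ENNReal.ofReal_toReal hi).symm⟩
  have h1s : 0 < 1 - s := by linarith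
  set t₀ : ℝ := (Real.pi / b) ^ (1 - s) with ht₀
  have ht₀p : 0 < t₀ := by positivity
  set e : ℝ := 1 / (1 - s) with he
  have he1 : 1 < e := by rw [he, lt_div_iff₀ h1s]; linarith
  have key : ∀ t ∈ Ioi (0 : ℝ), (volume.restrict B) {y | t < ‖x - y‖ ^ (-(2 - 2 * s))} ≤
      ENNReal.ofReal (Real.pi * t ^ (-e)) := by
    intro t ht
    have ht' : (0 : ℝ) < t := ht
    refine (Measure.restrict_apply_le _ _).trans ?_
    have hsub : {y | t < ‖x - y‖ ^ (-(2 - 2 * s))} ⊆ Metric.ball x (t ^ (-(e / 2))) := by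
      intro y hy
      simp only [mem_ofPred_eq] at hy
      rw [Metric.mem_ball, dist_comm, dist_eq_norm]
      rcases (norm_nonneg (x - y)).eq_or_lt with hz | hz
      · rw [← hz]; positivity
      by_contra! hle
      have : ‖x - y‖ ^ (-(2 - 2 * s)) ≤ (t ^ (-(e / 2))) ^ (-(2 - 2 * s)) :=
        Real.rpow_le_rpow_of_nonpos (by positivity) hle (by linarith)
      rw [← Real.rpow_mul ht'.le, show -(e / 2) * -(2 - 2 * s) = 1 by
        rw [he]; field_simp, Real.rpow_one] at this
      linarith
    refine (measure_mono hsub).trans ?_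
    rw [Complex.volume_ball, ← ENNReal.ofReal_pow (by positivity), ENNReal.ofReal_mul hpi.le, mul_comm]
    apply le_of_eq
    congr 1
    · rw [ENNReal.ofReal_eq_coe_nnreal hpi.le]; rfl
    · rw [← Real.rpow_natCast, ← Real.rpow_mul ht'.le]; congr 2; push_cast; ring
  have key2 : ∀ t, (volume.restrict B) {y | t < ‖x - y‖ ^ (-(2 - 2 * s))} ≤
      ENNReal.ofReal b := fun t => by
    rw [← hbB]; refine (measure_mono (subset_univ _)).trans ?_; simp
  unfold rieszKernel
  rw [lintegral_eq_lintegral_meas_lt _ (Filter.Eventually.of_forall fun y => by positivity)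
    (by fun_prop), ← Ioc_union_Ioi_eq_Ioi ht₀p.le,
    lintegral_union measurableSet_Ioi (Ioc_disjoint_Ioi le_rfl)]
  have h1 : ∫⁻ t in Ioc 0 t₀, (volume.restrict B) {y | t < ‖x - y‖ ^ (-(2 - 2 * s))} ≤
      ENNReal.ofReal (b * t₀) := by
    refine (lintegral_mono (fun t => key2 t)).trans ?_
    rw [setLIntegral_const, Real.volume_Ioc, ENNReal.ofReal_mul hb.le, sub_zero]
  have h2 : ∫⁻ t in Ioi t₀, (volume.restrict B) {y | t < ‖x - y‖ ^ (-(2 - 2 * s))} ≤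
      ENNReal.ofReal (Real.pi * (t₀ ^ (1 - e) / (e - 1))) := by
    rw [ENNReal.ofReal_mul hpi.le, ← lintegral_Ioi_ofReal_rpow he1 ht₀p, ← lintegral_const_mul _ (by fun_prop)]
    refine setLIntegral_mono (by fun_prop) fun t ht => ?_
    refine (key t (ht₀p.trans ht)).trans_eq ?_
    rw [ENNReal.ofReal_mul hpi.le]
  refine (add_le_add h1 h2).trans ?_
  have he2 : 0 < e - 1 := by linarith
  rw [hbB, ENNReal.ofReal_rpow_of_pos hb, ← ENNReal.ofReal_add (by positivity) (by positivity),
    ← ENNReal.ofReal_mul hc.le]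
  apply ENNReal.ofReal_le_ofReal
  apply le_of_eq
  have e1 : t₀ = Real.pi ^ (1 - s) * (b ^ s / b) := by
    rw [ht₀, Real.div_rpow hpi.le hb.le, Real.rpow_sub hb, Real.rpow_one]; field_simp
  have e2 : t₀ ^ (1 - e) = b ^ s / Real.pi ^ s := by
    rw [ht₀, ← Real.rpow_mul (by positivity), show (1 - s) * (1 - e) = -s by
      rw [he]; field_simp; ring, Real.rpow_neg (by positivity), Real.div_rpow hpi.le hb.le, inv_div]
  have e3 : e - 1 = s / (1 - s) := by rw [he]; field_simp; ring
  rw [e2, e3, e1, Real.rpow_sub hpi, Real.rpow_one]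
  field_simp
  ring

attribute [irreducible] rieszKernel

theorem lintegral_Ioc_ofReal_rpow {q a : ℝ} (hq : q < 1) (ha : 0 < a) :
    ∫⁻ u in Ioc 0 a, ENNReal.ofReal (u ^ (-q)) = ENNReal.ofReal (a ^ (1 - q) / (1 - q)) := by
  rw [← ofReal_integral_eq_lintegral_ofReal]
  · rw [← intervalIntegral.integral_of_le ha.le, integral_rpow (Or.inl (by linarith)),
      Real.zero_rpow (by linarith), sub_zero, show -q + 1 = 1 - q by ring]
  · rw [← IntegrableOn, ← intervalIntegrable_iff_integrableOn_Ioc_of_le ha.le]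
    exact intervalIntegral.intervalIntegrable_rpow' (by linarith)
  · filter_upwards [self_mem_ae_restrict measurableSet_Ioc] with u hu
    exact Real.rpow_nonneg hu.1.le _

theorem lintegral_triangle_mul_rpow_le {s : ℝ} (hs0 : 0 < s) (hs1 : s < 1) {v w : ℝ → ℝ≥0∞}
    (hv : Measurable v) (hw : Measurable w) {S : Set (ℝ × ℝ)} (hS : MeasurableSet S)
    (hS' : ∀ p ∈ S, p.2 ≤ p.1) {φ : ℝ → ℝ≥0∞}
    (hφ : φ = fun a => ENNReal.ofReal (a ^ ((1 - s) / (1 + s)))) :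
    ∫⁻ a in Ioi 0, ∫⁻ b in Ioi 0, S.indicator (fun p => v p.1 * w p.2 ^ s) (a, b) ≤
      (∫⁻ a in Ioi 0, ∫⁻ b in Ioi 0,
        S.indicator (fun p => (v p.1 * φ p.1) * (w p.2 * φ p.2)) (a, b)) ^ s *
      (ENNReal.ofReal (1 + s) * ∫⁻ a in Ioi 0, v a * φ a) ^ (1 - s) := by
  have h1s : 0 < 1 - s := by linarith
  set q : ℝ := s / (1 + s) with hq
  have hq1 : q < 1 := by rw [hq, div_lt_one (by linarith)]; linarith
  have hφm : Measurable φ := by rw [hφ]; fun_prop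
  have hX : Measurable (fun p : ℝ × ℝ =>
      S.indicator (fun p => (v p.1 * φ p.1) * (w p.2 * φ p.2)) p) :=
    Measurable.indicator (by fun_prop) hS
  let G : ℝ × ℝ → ℝ≥0∞ := fun p =>
    (Iic p.1).indicator (fun b => v p.1 * ENNReal.ofReal (p.1 ^ (-q)) * ENNReal.ofReal (b ^ (-q))) p.2
  have hG : Measurable G := by
    have : G = {p : ℝ × ℝ | p.2 ≤ p.1}.indicator (fun p =>
        v p.1 * ENNReal.ofReal (p.1 ^ (-q)) * ENNReal.ofReal (p.2 ^ (-q))) := by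
      ext p; simp [G, indicator]
    rw [this]
    exact Measurable.indicator (by fun_prop) (measurableSet_le measurable_snd measurable_fst)
  have hpt : ∀ a ∈ Ioi (0 : ℝ), ∀ b ∈ Ioi (0 : ℝ),
      S.indicator (fun p => v p.1 * w p.2 ^ s) (a, b) ≤
      (S.indicator (fun p => (v p.1 * φ p.1) * (w p.2 * φ p.2)) (a, b)) ^ s * G (a, b) ^ (1 - s) := by
    intro a ha b hb
    have ha' : (0 : ℝ) < a := ha
    have hb' : (0 : ℝ) < b := hb
    by_cases hab : (a, b) ∈ S
    · have hle : b ≤ a := hS' _ hab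
      have hc : ∀ t : ℝ, 0 < t → φ t ^ s * ENNReal.ofReal (t ^ (-q)) ^ (1 - s) = 1 := by
        intro t ht
        rw [hφ, ENNReal.ofReal_rpow_of_pos (by positivity),
          ENNReal.ofReal_rpow_of_pos (by positivity), ← ENNReal.ofReal_mul (by positivity),
          ← Real.rpow_mul ht.le, ← Real.rpow_mul ht.le, ← Real.rpow_add ht,
          show (1 - s) / (1 + s) * s + -q * (1 - s) = 0 by rw [hq]; field_simp; ring]
        simp
      simp only [indicator_of_mem hab, G, indicator_of_mem (mem_Iic.2 hle)]
      rw [ENNReal.mul_rpow_of_nonneg _ _ hs0.le, ENNReal.mul_rpow_of_nonneg _ _ hs0.le,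
        ENNReal.mul_rpow_of_nonneg _ _ hs0.le, ENNReal.mul_rpow_of_nonneg _ _ h1s.le,
        ENNReal.mul_rpow_of_nonneg _ _ h1s.le]
      apply le_of_eq
      calc v a * w b ^ s
          = v a ^ s * v a ^ (1 - s) * w b ^ s * (φ a ^ s * ENNReal.ofReal (a ^ (-q)) ^ (1 - s)) *
              (φ b ^ s * ENNReal.ofReal (b ^ (-q)) ^ (1 - s)) := by
            rw [← ENNReal.rpow_add_of_nonneg _ _ hs0.le h1s.le, hc a ha', hc b hb']; simp
        _ = _ := by ring
    · simp [indicator_of_notMem hab]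
  have hYa : ∀ a ∈ Ioi (0 : ℝ), ∫⁻ b in Ioi 0, G (a, b) = ENNReal.ofReal (1 + s) * (v a * φ a) := by
    intro a ha
    have ha' : (0 : ℝ) < a := ha
    simp only [G]
    rw [setLIntegral_indicator measurableSet_Iic, inter_comm, Ioi_inter_Iic,
      lintegral_const_mul _ (by fun_prop), lintegral_Ioc_ofReal_rpow hq1 ha', mul_assoc,
      ← ENNReal.ofReal_mul (by positivity), hφ, mul_left_comm,
      ← ENNReal.ofReal_mul (by linarith)]
    congr 2
    rw [mul_div_assoc', ← Real.rpow_add ha',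
      show -q + (1 - q) = (1 - s) / (1 + s) by rw [hq]; field_simp; ring,
      show 1 - q = 1 / (1 + s) by rw [hq]; field_simp; ring]
    field_simp
  calc _ ≤ ∫⁻ a in Ioi 0, (∫⁻ b in Ioi 0,
        S.indicator (fun p => (v p.1 * φ p.1) * (w p.2 * φ p.2)) (a, b)) ^ s *
        (ENNReal.ofReal (1 + s) * (v a * φ a)) ^ (1 - s) := by
        refine setLIntegral_mono' measurableSet_Ioi fun a ha => ?_
        rw [← hYa a ha]
        refine (setLIntegral_mono' measurableSet_Ioi (hpt a ha)).trans ?_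
        exact ENNReal.lintegral_mul_norm_pow_le
          (hX.comp measurable_prodMk_left).aemeasurable (hG.comp measurable_prodMk_left).aemeasurable
          hs0.le h1s.le (by ring)
    _ ≤ _ := by
        refine (ENNReal.lintegral_mul_norm_pow_le hX.lintegral_prod_right'.aemeasurable
          (by fun_prop) hs0.le h1s.le (by ring)).trans_eq ?_
        rw [lintegral_const_mul _ (by fun_prop)]

/-- An explicit admissible constant in the diagonal Hardy–Littlewood–Sobolev inequality. -/
noncomputable def hlsConst (s : ℝ) : ℝ := Real.pi ^ (1 - s) / s * ((1 + s) ^ 2 * 4 ^ (-s))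

theorem hlsConst_pos {s : ℝ} (hs : 0 < s) : 0 < hlsConst s := by
  have := Real.pi_pos
  unfold hlsConst
  positivity

theorem lintegral_levelSets {Φ : ℂ → ℝ≥0∞} (hΦ : Measurable Φ) {f : ℂ → ℝ} (hf : Measurable f)
    (hf0 : ∀ x, 0 ≤ f x) :
    ∫⁻ x, ENNReal.ofReal (f x) * Φ x = ∫⁻ a in Ioi 0, ∫⁻ x in {x | a < f x}, Φ x := by
  have h := lintegral_eq_lintegral_meas_lt ((volume : Measure ℂ).withDensity Φ)
    (Filter.Eventually.of_forall hf0) hf.aemeasurable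
  rw [lintegral_withDensity_eq_lintegral_mul _ hΦ (by fun_prop)] at h
  simp only [Pi.mul_apply, mul_comm (Φ _)] at h
  rw [h]
  refine lintegral_congr fun a => ?_
  rw [withDensity_apply _ (measurableSet_lt measurable_const hf)]

theorem lintegral_levelSets_le {s : ℝ} (hs0 : 0 < s) (hs1 : s < 1) {v w : ℝ → ℝ≥0∞}
    (hv : Measurable v) (hw : Measurable w) {φ : ℝ → ℝ≥0∞}
    (hφ : φ = fun a => ENNReal.ofReal (a ^ ((1 - s) / (1 + s))))
    (hvT : ∫⁻ a in Ioi 0, v a * φ a = ENNReal.ofReal ((1 + s) / 2))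
    (hwT : ∫⁻ a in Ioi 0, w a * φ a = ENNReal.ofReal ((1 + s) / 2)) {E : ℝ → ℝ → ℝ≥0∞}
    {c : ℝ≥0∞} (hE₁ : ∀ a b, E a b ≤ c * (v a * w b ^ s)) (hE₂ : ∀ a b, E a b ≤ c * (w b * v a ^ s)) :
    ∫⁻ a in Ioi 0, ∫⁻ b in Ioi 0, E a b ≤ c * ENNReal.ofReal ((1 + s) ^ 2 * 4 ^ (-s)) := by
  have h1s : 0 < 1 - s := by linarith
  have hφm : Measurable φ := by rw [hφ]; fun_prop
  set S : Set (ℝ × ℝ) := {p | p.2 ≤ p.1} with hS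
  have hSm : MeasurableSet S := measurableSet_le measurable_snd measurable_fst
  set S' : Set (ℝ × ℝ) := {p | p.2 < p.1} with hS'
  have hSm' : MeasurableSet S' := measurableSet_lt measurable_snd measurable_fst
  have k1 := lintegral_triangle_mul_rpow_le hs0 hs1 hv hw hSm (fun p hp => hp) hφ
  have k2 := lintegral_triangle_mul_rpow_le hs0 hs1 hw hv hSm' (fun p hp => le_of_lt hp) hφ
  rw [hvT] at k1
  rw [hwT] at k2
  set X₁ := ∫⁻ a in Ioi 0, ∫⁻ b in Ioi 0,
    S.indicator (fun p => (v p.1 * φ p.1) * (w p.2 * φ p.2)) (a, b) with hX₁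
  set X₂ := ∫⁻ a in Ioi 0, ∫⁻ b in Ioi 0,
    S'.indicator (fun p => (w p.1 * φ p.1) * (v p.2 * φ p.2)) (a, b) with hX₂
  have swap : ∀ F : ℝ × ℝ → ℝ≥0∞, Measurable F →
      ∫⁻ a in Ioi 0, ∫⁻ b in Ioi 0, S'.indicator F (a, b) =
      ∫⁻ a in Ioi 0, ∫⁻ b in Ioi 0, S'.indicator F (b, a) := fun F hF =>
    lintegral_lintegral_swap (hF.indicator hSm').aemeasurable
  have hX : X₁ + X₂ = ENNReal.ofReal ((1 + s) / 2) ^ 2 := by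
    rw [hX₂, swap _ (by fun_prop), hX₁, ← lintegral_add_left]
    · calc _ = ∫⁻ a in Ioi 0, ∫⁻ b in Ioi 0, (v a * φ a) * (w b * φ b) := by
            refine lintegral_congr fun a => ?_
            rw [← lintegral_add_left]
            · refine lintegral_congr fun b => ?_
              by_cases h : b ≤ a
              · simp [S, S', indicator, h, not_lt.2 h]
              · simp [S, S', indicator, h, not_le.1 h, mul_comm]
            · exact (Measurable.indicator (by fun_prop) hSm).comp measurable_prodMk_left
        _ = _ := by
            have e : ∀ a, ∫⁻ b in Ioi 0, (v a * φ a) * (w b * φ b) =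
                (v a * φ a) * ENNReal.ofReal ((1 + s) / 2) := fun a => by
              rw [← hwT]; exact lintegral_const_mul _ (hw.mul hφm)
            simp_rw [e]
            rw [sq, ← hvT]
            exact lintegral_mul_const _ (hv.mul hφm)
    · exact (Measurable.indicator (by fun_prop) hSm).lintegral_prod_right'
  have hsplit : ∀ a b, E a b ≤ c * (S.indicator (fun p => v p.1 * w p.2 ^ s) (a, b) +
      S'.indicator (fun p => w p.1 * v p.2 ^ s) (b, a)) := by
    intro a b
    by_cases h : b ≤ a
    · simpa [S, S', indicator, h, not_lt.2 h] using hE₁ a b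
    · simpa [S, S', indicator, h, not_le.1 h] using hE₂ a b
  have hm1 : Measurable (fun p : ℝ × ℝ => S.indicator (fun p => v p.1 * w p.2 ^ s) p) :=
    Measurable.indicator (by fun_prop) hSm
  have hm2 : Measurable (fun p : ℝ × ℝ => S'.indicator (fun p => w p.1 * v p.2 ^ s) p.swap) :=
    (Measurable.indicator (by fun_prop) hSm').comp measurable_swap
  calc ∫⁻ a in Ioi 0, ∫⁻ b in Ioi 0, E a b
      ≤ ∫⁻ a in Ioi 0, ∫⁻ b in Ioi 0, c * (S.indicator (fun p => v p.1 * w p.2 ^ s) (a, b) +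
          S'.indicator (fun p => w p.1 * v p.2 ^ s) (b, a)) :=
        lintegral_mono fun a => lintegral_mono fun b => hsplit a b
    _ = c * ((∫⁻ a in Ioi 0, ∫⁻ b in Ioi 0, S.indicator (fun p => v p.1 * w p.2 ^ s) (a, b)) +
          ∫⁻ a in Ioi 0, ∫⁻ b in Ioi 0, S'.indicator (fun p => w p.1 * v p.2 ^ s) (a, b)) := by
        have hm3 : Measurable (fun p : ℝ × ℝ => S.indicator (fun p => v p.1 * w p.2 ^ s) p +
          S'.indicator (fun p => w p.1 * v p.2 ^ s) p.swap) := hm1.add hm2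
        have e1 : ∀ a, ∫⁻ b in Ioi 0, c * (S.indicator (fun p => v p.1 * w p.2 ^ s) (a, b) +
          S'.indicator (fun p => w p.1 * v p.2 ^ s) (b, a)) =
          c * ∫⁻ b in Ioi 0, (S.indicator (fun p => v p.1 * w p.2 ^ s) (a, b) +
          S'.indicator (fun p => w p.1 * v p.2 ^ s) (b, a)) := fun a =>
          lintegral_const_mul c (hm3.comp measurable_prodMk_left)
        simp_rw [e1]
        rw [swap _ (by fun_prop), ← lintegral_add_left hm1.lintegral_prod_right']
        refine (lintegral_const_mul c hm3.lintegral_prod_right').trans ?_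
        congr 1
        refine lintegral_congr fun a => ?_
        exact lintegral_add_left (hm1.comp measurable_prodMk_left) _
    _ ≤ c * ((X₁ ^ s + X₂ ^ s) *
          (ENNReal.ofReal (1 + s) * ENNReal.ofReal ((1 + s) / 2)) ^ (1 - s)) := by
        rw [add_mul]; gcongr
    _ ≤ c * ((2 ^ (1 - s) * (ENNReal.ofReal ((1 + s) / 2) ^ 2) ^ s) *
          (ENNReal.ofReal (1 + s) * ENNReal.ofReal ((1 + s) / 2)) ^ (1 - s)) := by
        gcongr
        have h := ENNReal.rpow_add_le_mul_rpow_add_rpow (X₁ ^ s) (X₂ ^ s)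
          (p := 1 / s) (by rw [le_div_iff₀ hs0]; linarith)
        rw [← ENNReal.rpow_mul, ← ENNReal.rpow_mul, mul_one_div_cancel hs0.ne', ENNReal.rpow_one,
          ENNReal.rpow_one, hX] at h
        have h' := ENNReal.rpow_le_rpow h hs0.le
        rw [← ENNReal.rpow_mul, one_div_mul_cancel hs0.ne', ENNReal.rpow_one,
          ENNReal.mul_rpow_of_nonneg _ _ hs0.le, ← ENNReal.rpow_mul,
          show (1 / s - 1) * s = 1 - s by field_simp] at h'
        exact h'
    _ ≤ _ := by
        gcongr
        rw [← ENNReal.ofReal_pow (by positivity), ← ENNReal.ofReal_mul (by positivity),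
          ENNReal.ofReal_rpow_of_pos (by positivity), ENNReal.ofReal_rpow_of_pos (by positivity),
          show (2 : ℝ≥0∞) = ENNReal.ofReal 2 by simp, ENNReal.ofReal_rpow_of_pos (by positivity),
          ← ENNReal.ofReal_mul (by positivity), ← ENNReal.ofReal_mul (by positivity)]
        apply ENNReal.ofReal_le_ofReal
        apply le_of_eq
        have hx : 0 < 1 + s := by linarith
        have h4 : (4 : ℝ) ^ (-s) = 1 / (2 ^ s * 2 ^ s) := by
          rw [show (4 : ℝ) = 2 * 2 by norm_num, Real.mul_rpow (by norm_num) (by norm_num),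
            Real.rpow_neg (by norm_num)]; field_simp
        rw [h4, show ((1 + s) / 2) ^ 2 = (1 + s) * (1 + s) / (2 * 2) by ring,
          show (1 + s) * ((1 + s) / 2) = (1 + s) * (1 + s) / 2 by ring,
          Real.div_rpow (by positivity) (by positivity),
          Real.div_rpow (by positivity) (by positivity),
          Real.mul_rpow (by positivity) (by positivity),
          Real.mul_rpow (by positivity) (by positivity),
          Real.mul_rpow (by positivity) (by positivity),
          Real.rpow_sub hx, Real.rpow_one]
        field_simp

theorem lintegral_rieszKernel_mul_le_of_norm_eq_one {s : ℝ} (hs0 : 0 < s) (hs1 : s < 1)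
    {f g : ℂ → ℝ} (hf : Measurable f) (hg : Measurable g) (hf0 : ∀ x, 0 ≤ f x) (hg0 : ∀ x, 0 ≤ g x)
    (hfn : ∫⁻ x, ENNReal.ofReal (f x ^ (2 / (1 + s))) = 1)
    (hgn : ∫⁻ x, ENNReal.ofReal (g x ^ (2 / (1 + s))) = 1) :
    ∫⁻ x, ∫⁻ y, ENNReal.ofReal (f x) * (ENNReal.ofReal (g y) * rieszKernel s x y) ≤
      ENNReal.ofReal (hlsConst s) := by
  have hk := measurable_rieszKernel s
  have hks : Measurable (fun p : ℂ × ℂ => rieszKernel s p.2 p.1) := hk.comp measurable_swap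
  have hm : ∀ {f : ℂ → ℝ}, Measurable f → Measurable fun a => volume {x | a < f x} := fun {f} _ =>
    Antitone.measurable fun a b hab => measure_mono fun x (hx : b < f x) => hab.trans_lt hx
  have hT : ∀ {f : ℂ → ℝ}, Measurable f → (∀ x, 0 ≤ f x) →
      ∫⁻ x, ENNReal.ofReal (f x ^ (2 / (1 + s))) = 1 →
      ∫⁻ a in Ioi 0, volume {x | a < f x} * ENNReal.ofReal (a ^ ((1 - s) / (1 + s))) =
        ENNReal.ofReal ((1 + s) / 2) := by
    intro f hf hf0 hfn
    rw [lintegral_rpow_eq_lintegral_meas_lt_mul _ (Filter.Eventually.of_forall hf0)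
      hf.aemeasurable (by positivity), show 2 / (1 + s) - 1 = (1 - s) / (1 + s) by
        field_simp; ring] at hfn
    have hone : ENNReal.ofReal ((1 + s) / 2) * ENNReal.ofReal (2 / (1 + s)) = 1 := by
      rw [← ENNReal.ofReal_mul (by positivity), show (1 + s) / 2 * (2 / (1 + s)) = 1 by field_simp,
        ENNReal.ofReal_one]
    rw [← one_mul (lintegral _ _), ← hone, mul_assoc, hfn, mul_one]
  have hE : ∀ a b, ∫⁻ y in {y | b < g y}, ∫⁻ x in {x | a < f x}, rieszKernel s x y ≤
      ENNReal.ofReal (Real.pi ^ (1 - s) / s) * (volume {y | b < g y} * volume {x | a < f x} ^ s) := by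
    intro a b
    refine (lintegral_mono (g := fun _ => ENNReal.ofReal (Real.pi ^ (1 - s) / s) *
      volume {x | a < f x} ^ s) fun y => ?_).trans_eq ?_
    · simp_rw [rieszKernel_comm s _ y]
      exact setLIntegral_rieszKernel_le hs0 hs1 _ y
    · rw [setLIntegral_const]; ring
  have hE' : ∀ a b, ∫⁻ y in {y | b < g y}, ∫⁻ x in {x | a < f x}, rieszKernel s x y ≤
      ENNReal.ofReal (Real.pi ^ (1 - s) / s) * (volume {x | a < f x} * volume {y | b < g y} ^ s) := by
    intro a b
    rw [lintegral_lintegral_swap (f := fun y x => rieszKernel s x y) hks.aemeasurable]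
    refine (lintegral_mono (g := fun _ => ENNReal.ofReal (Real.pi ^ (1 - s) / s) *
      volume {y | b < g y} ^ s) fun x => ?_).trans_eq ?_
    · exact setLIntegral_rieszKernel_le hs0 hs1 _ x
    · rw [setLIntegral_const]; ring
  calc _ = ∫⁻ a in Ioi 0, ∫⁻ b in Ioi 0, ∫⁻ y in {y | b < g y},
        ∫⁻ x in {x | a < f x}, rieszKernel s x y := by
        have hgk : Measurable (fun p : ℂ × ℂ => ENNReal.ofReal (g p.2) * rieszKernel s p.1 p.2) := by
          fun_prop
        have e1 : ∀ x, ∫⁻ y, ENNReal.ofReal (f x) * (ENNReal.ofReal (g y) * rieszKernel s x y) =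
            ENNReal.ofReal (f x) * ∫⁻ y, ENNReal.ofReal (g y) * rieszKernel s x y := fun x =>
          lintegral_const_mul _ (hgk.comp measurable_prodMk_left)
        simp_rw [e1]
        have hgI : Measurable fun x => ∫⁻ y, ENNReal.ofReal (g y) * rieszKernel s x y :=
          hgk.lintegral_prod_right'
        rw [lintegral_levelSets hgI hf hf0]
        refine lintegral_congr fun a => ?_
        rw [lintegral_lintegral_swap (f := fun x y => ENNReal.ofReal (g y) * rieszKernel s x y)
          hgk.aemeasurable]
        have e2 : ∀ y, ∫⁻ x in {x | a < f x}, ENNReal.ofReal (g y) * rieszKernel s x y =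
            ENNReal.ofReal (g y) * ∫⁻ x in {x | a < f x}, rieszKernel s x y := fun y =>
          lintegral_const_mul _ (hk.comp measurable_prodMk_right)
        simp_rw [e2]
        have hkI : Measurable fun y => ∫⁻ x in {x | a < f x}, rieszKernel s x y :=
          hk.lintegral_prod_left'
        exact lintegral_levelSets hkI hg hg0
    _ ≤ _ := by
        unfold hlsConst
        have := Real.pi_pos
        rw [ENNReal.ofReal_mul (by positivity)]
        exact lintegral_levelSets_le hs0 hs1 (hm hf) (hm hg) rfl (hT hf hf0 hfn) (hT hg hg0 hgn)
          hE' hE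

theorem lintegral_rieszKernel_mul_le {s : ℝ} (hs0 : 0 < s) (hs1 : s < 1) {f g : ℂ → ℝ≥0∞}
    (hf : Measurable f) (hg : Measurable g) :
    ∫⁻ x, ∫⁻ y, f x * (g y * rieszKernel s x y) ≤ ENNReal.ofReal (hlsConst s) *
      ((∫⁻ x, f x ^ (2 / (1 + s))) ^ ((1 + s) / 2) *
        (∫⁻ y, g y ^ (2 / (1 + s))) ^ ((1 + s) / 2)) := by
  have hp : 0 < 2 / (1 + s) := by positivity
  have hq : 0 < (1 + s) / 2 := by positivity
  have hpq : 2 / (1 + s) * ((1 + s) / 2) = 1 := by field_simp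
  have hK : ENNReal.ofReal (hlsConst s) ≠ 0 := by simpa using hlsConst_pos hs0
  have zero_case : ∀ {u : ℂ → ℝ≥0∞}, Measurable u → ∫⁻ x, u x ^ (2 / (1 + s)) = 0 →
      ∀ᵐ x, u x = 0 := by
    intro u hu h
    rw [lintegral_eq_zero_iff (by fun_prop)] at h
    filter_upwards [h] with x hx
    simpa [hp, hp.not_gt] using hx
  rcases eq_or_ne (∫⁻ x, f x ^ (2 / (1 + s))) 0 with hf0 | hf0
  · refine le_of_eq_of_le ?_ zero_le
    rw [← lintegral_zero (μ := (volume : Measure ℂ))]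
    refine lintegral_congr_ae ?_
    filter_upwards [zero_case hf hf0] with x hx
    simp [hx]
  rcases eq_or_ne (∫⁻ x, g x ^ (2 / (1 + s))) 0 with hg0 | hg0
  · refine le_of_eq_of_le ?_ zero_le
    rw [← lintegral_zero (μ := (volume : Measure ℂ))]
    refine lintegral_congr fun x => ?_
    rw [← lintegral_zero (μ := (volume : Measure ℂ))]
    refine lintegral_congr_ae ?_
    filter_upwards [zero_case hg hg0] with y hy
    simp [hy]
  rcases eq_or_ne (∫⁻ x, f x ^ (2 / (1 + s))) ∞ with hfi | hfi
  · rw [hfi, ENNReal.top_rpow_of_pos hq, ENNReal.top_mul (by simp [hg0, hq.le]),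
      ENNReal.mul_top hK]
    exact le_top
  rcases eq_or_ne (∫⁻ x, g x ^ (2 / (1 + s))) ∞ with hgi | hgi
  · rw [hgi, ENNReal.top_rpow_of_pos hq, ENNReal.mul_top (by simp [hf0, hq.le]),
      ENNReal.mul_top hK]
    exact le_top
  have finite_case : ∀ {u : ℂ → ℝ≥0∞}, Measurable u → ∫⁻ x, u x ^ (2 / (1 + s)) ≠ ∞ →
      ∀ᵐ x, u x ≠ ∞ := by
    intro u hu h
    filter_upwards [ae_lt_top (by fun_prop) h] with x hx hxi
    simp [hxi, hp] at hx
  have normalize : ∀ {u : ℂ → ℝ≥0∞}, Measurable u → ∫⁻ x, u x ^ (2 / (1 + s)) ≠ 0 →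
      ∫⁻ x, u x ^ (2 / (1 + s)) ≠ ∞ → ∃ v : ℂ → ℝ, Measurable v ∧ (∀ x, 0 ≤ v x) ∧
        ∫⁻ x, ENNReal.ofReal (v x ^ (2 / (1 + s))) = 1 ∧
        ∀ᵐ x, u x = (∫⁻ x, u x ^ (2 / (1 + s))) ^ ((1 + s) / 2) * ENNReal.ofReal (v x) := by
    intro u hu h0 hi
    set A := (∫⁻ x, u x ^ (2 / (1 + s))) ^ ((1 + s) / 2) with hA
    have hA0 : A ≠ 0 := by simp [hA, h0, hi]
    have hAi : A ≠ ∞ := by simp [hA, h0, hi]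
    have hae : ∀ᵐ x, ENNReal.ofReal (A⁻¹ * u x).toReal = A⁻¹ * u x := by
      filter_upwards [finite_case hu hi] with x hx
      exact ENNReal.ofReal_toReal (ENNReal.mul_ne_top (by simpa using hA0) hx)
    refine ⟨fun x => (A⁻¹ * u x).toReal, by fun_prop, fun _ => ENNReal.toReal_nonneg, ?_, ?_⟩
    · calc _ = ∫⁻ x, (A⁻¹) ^ (2 / (1 + s)) * u x ^ (2 / (1 + s)) := by
            refine lintegral_congr_ae ?_
            filter_upwards [hae] with x hx
            rw [← ENNReal.ofReal_rpow_of_nonneg ENNReal.toReal_nonneg hp.le, hx,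
              ENNReal.mul_rpow_of_nonneg _ _ hp.le]
        _ = 1 := by
            rw [lintegral_const_mul _ (by fun_prop), ENNReal.inv_rpow, hA, ← ENNReal.rpow_mul,
              mul_comm ((1 + s) / 2), hpq, ENNReal.rpow_one, ENNReal.inv_mul_cancel h0 hi]
    · filter_upwards [hae] with x hx
      rw [hx, ← mul_assoc, ENNReal.mul_inv_cancel hA0 hAi, one_mul]
  obtain ⟨v, hv, hv0, hvn, hfv⟩ := normalize hf hf0 hfi
  obtain ⟨w, hw, hw0, hwn, hgw⟩ := normalize hg hg0 hgi
  set A := (∫⁻ x, f x ^ (2 / (1 + s))) ^ ((1 + s) / 2)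
  set B := (∫⁻ x, g x ^ (2 / (1 + s))) ^ ((1 + s) / 2)
  have hk := measurable_rieszKernel s
  have hm : Measurable fun p : ℂ × ℂ =>
    ENNReal.ofReal (v p.1) * (ENNReal.ofReal (w p.2) * rieszKernel s p.1 p.2) := by fun_prop
  have hI : Measurable fun x => ∫⁻ y,
    ENNReal.ofReal (v x) * (ENNReal.ofReal (w y) * rieszKernel s x y) := hm.lintegral_prod_right'
  calc _ = ∫⁻ x, (A * B) * ∫⁻ y,
        ENNReal.ofReal (v x) * (ENNReal.ofReal (w y) * rieszKernel s x y) := by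
        refine lintegral_congr_ae ?_
        filter_upwards [hfv] with x hx
        refine Eq.trans ?_ (lintegral_const_mul _ (hm.comp measurable_prodMk_left))
        refine lintegral_congr_ae ?_
        filter_upwards [hgw] with y hy
        rw [hx, hy]; ring
    _ ≤ _ := by
        rw [lintegral_const_mul _ hI, mul_comm]
        gcongr
        exact lintegral_rieszKernel_mul_le_of_norm_eq_one hs0 hs1 hv hw hv0 hw0 hvn hwn

theorem lintegral_rpow_lintegral_rieszKernel_le {s : ℝ} (hs0 : 0 < s) (hs1 : s < 1)
    {g : ℂ → ℝ≥0∞} (hg : Measurable g) :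
    ∫⁻ x, (∫⁻ y, g y * rieszKernel s x y) ^ (2 / (1 - s)) ≤
      (ENNReal.ofReal (hlsConst s) * (∫⁻ y, g y ^ (2 / (1 + s))) ^ ((1 + s) / 2)) ^
        (2 / (1 - s)) := by
  have h1s : 0 < 1 - s := by linarith
  have hk := measurable_rieszKernel s
  have hgk : Measurable (fun p : ℂ × ℂ => g p.2 * rieszKernel s p.1 p.2) := by fun_prop
  set F : ℂ → ℝ≥0∞ := fun x => ∫⁻ y, g y * rieszKernel s x y with hF
  have hFm : Measurable F := hgk.lintegral_prod_right'
  set A := ENNReal.ofReal (hlsConst s) * (∫⁻ y, g y ^ (2 / (1 + s))) ^ ((1 + s) / 2) with hA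
  have hp : 0 < 2 / (1 - s) := by positivity
  let u : ℕ → ℂ → ℝ≥0∞ := fun n => (Metric.ball 0 n).indicator fun x => min (F x) n
  have hu : ∀ n, Measurable (u n) := fun n =>
    (hFm.min measurable_const).indicator Metric.isOpen_ball.measurableSet
  have huF : ∀ n x, u n x ≤ F x := fun n x =>
    (indicator_le_self _ _ _).trans (min_le_left _ _)
  have hbound : ∀ n, ∫⁻ x, u n x ^ (2 / (1 - s)) ≤ A ^ (2 / (1 - s)) := by
    intro n
    set T := ∫⁻ x, u n x ^ (2 / (1 - s)) with hT
    have hTi : T ≠ ∞ := by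
      refine ne_top_of_le_ne_top (b := (n : ℝ≥0∞) ^ (2 / (1 - s)) * volume (Metric.ball (0:ℂ) n)) 
        (ENNReal.mul_ne_top (by simp [hp.le]) measure_ball_lt_top.ne) ?_
      rw [← setLIntegral_const, ← lintegral_indicator Metric.isOpen_ball.measurableSet]
      refine lintegral_mono fun x => ?_
      by_cases hx : x ∈ Metric.ball (0 : ℂ) n
      · simp only [u, indicator_of_mem hx]
        gcongr
        exact min_le_right _ _
      · simp [u, indicator_of_notMem hx, hp]
    have h1 : T ≤ A * T ^ ((1 + s) / 2) := by
      calc T ≤ ∫⁻ x, ∫⁻ y, u n x ^ (2 / (1 - s) - 1) * (g y * rieszKernel s x y) := by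
            refine lintegral_mono fun x => ?_
            have e : ∫⁻ y, u n x ^ (2 / (1 - s) - 1) * (g y * rieszKernel s x y) =
                u n x ^ (2 / (1 - s) - 1) * F x :=
              lintegral_const_mul _ (hgk.comp measurable_prodMk_left)
            rw [e]
            have : 2 / (1 - s) = (2 / (1 - s) - 1) + 1 := by ring
            have h2 : 0 ≤ 2 / (1 - s) - 1 := by
              rw [sub_nonneg, le_div_iff₀ h1s]; linarith
            conv_lhs => rw [this, ENNReal.rpow_add_of_nonneg _ _ h2 zero_le_one, ENNReal.rpow_one]
            gcongr
            exact huF n x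
        _ ≤ _ := by
            refine (lintegral_rieszKernel_mul_le hs0 hs1 ((hu n).pow_const _) hg).trans_eq ?_
            have e : ∀ x, (u n x ^ (2 / (1 - s) - 1)) ^ (2 / (1 + s)) = u n x ^ (2 / (1 - s)) := by
              intro x
              rw [← ENNReal.rpow_mul]
              congr 1
              field_simp; ring
            simp_rw [e]
            rw [← hT, hA]; ring
    rcases eq_or_ne T 0 with h0 | h0
    · rw [h0]; exact zero_le
    have h3 : T ^ ((1 - s) / 2) ≤ A := by
      have h4 : T ^ ((1 - s) / 2) = T / T ^ ((1 + s) / 2) := by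
        conv_rhs => rw [← ENNReal.rpow_one T, ← ENNReal.rpow_mul, one_mul, ← ENNReal.rpow_sub _ _ h0 hTi]
        congr 1; ring
      rw [h4]
      exact ENNReal.div_le_of_le_mul h1
    calc T = (T ^ ((1 - s) / 2)) ^ (2 / (1 - s)) := by
          rw [← ENNReal.rpow_mul, show (1 - s) / 2 * (2 / (1 - s)) = 1 by field_simp, ENNReal.rpow_one]
      _ ≤ _ := by gcongr
  have hmono : ∀ x, Monotone fun n => u n x := by
    intro x m n hmn
    have hmn' : (m : ℝ) ≤ n := by exact_mod_cast hmn
    refine (indicator_le_indicator_of_subset (Metric.ball_subset_ball hmn') (fun _ => zero_le) x).trans ?_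
    refine indicator_le_indicator ?_
    gcongr
  have hsup : ∀ x, Filter.Tendsto (fun n => u n x ^ (2 / (1 - s))) Filter.atTop
      (nhds (F x ^ (2 / (1 - s)))) := by
    intro x
    refine (ENNReal.continuous_rpow_const.tendsto _).comp ?_
    have h5 : Filter.Tendsto (fun n : ℕ => min (F x) (n : ℝ≥0∞)) Filter.atTop (nhds (min (F x) ∞)) :=
      tendsto_const_nhds.min ENNReal.tendsto_nat_nhds_top
    rw [min_eq_left le_top] at h5
    refine h5.congr' ?_
    obtain ⟨N, hN⟩ := exists_nat_gt ‖x‖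
    filter_upwards [Filter.eventually_ge_atTop N] with n hn
    have : x ∈ Metric.ball (0 : ℂ) n := by
      rw [mem_ball_zero_iff]; exact hN.trans_le (by exact_mod_cast hn)
    simp [u, indicator_of_mem this]
  have hlim := lintegral_tendsto_of_tendsto_of_monotone (μ := (volume : Measure ℂ))
    (f := fun n x => u n x ^ (2 / (1 - s))) (F := fun x => F x ^ (2 / (1 - s)))
    (fun n => ((hu n).pow_const _).aemeasurable)
    (Filter.Eventually.of_forall fun x m n hmn => by
      dsimp only
      gcongr
      exact hmono x hmn)
    (Filter.Eventually.of_forall hsup)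
  exact le_of_tendsto' hlim hbound

/-- The `Lᵖ` seminorm of a nonnegative function, as a lower integral. -/
noncomputable def lpLIntegral {α : Type*} [MeasureSpace α] (p : ℝ) (f : α → ℝ≥0∞) : ℝ≥0∞ :=
  (∫⁻ x, f x ^ p) ^ (1 / p)

theorem lpLIntegral_mul_le {α : Type*} [MeasureSpace α] {p q r : ℝ} (hp : 0 < p) (hpq : p < q)
    (hpqr : 1 / p = 1 / q + 1 / r) {f g : α → ℝ≥0∞} (hf : Measurable f) (hg : Measurable g) :
    lpLIntegral p (fun x => f x * g x) ≤ lpLIntegral q f * lpLIntegral r g :=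
  ENNReal.lintegral_Lp_mul_le_Lq_mul_Lr hp hpq hpqr volume hf.aemeasurable hg.aemeasurable

theorem lpLIntegral_lintegral_rieszKernel_le {s : ℝ} (hs0 : 0 < s) (hs1 : s < 1)
    {g : ℂ → ℝ≥0∞} (hg : Measurable g) :
    lpLIntegral (2 / (1 - s)) (fun x => ∫⁻ y, g y * rieszKernel s x y) ≤
      ENNReal.ofReal (hlsConst s) * lpLIntegral (2 / (1 + s)) g := by
  have h1s : 0 < 1 - s := by linarith
  refine (ENNReal.rpow_le_rpow (lintegral_rpow_lintegral_rieszKernel_le hs0 hs1 hg)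
    (by positivity)).trans_eq ?_
  rw [← ENNReal.rpow_mul, show 2 / (1 - s) * (1 / (2 / (1 - s))) = 1 by field_simp,
    ENNReal.rpow_one, lpLIntegral, one_div_div]

theorem lpLIntegral_cauchy_le {g : ℂ → ℝ≥0∞} (hg : Measurable g) :
    lpLIntegral 4 (fun x => ∫⁻ y, g y * rieszKernel (1 / 2) x y) ≤
      ENNReal.ofReal (hlsConst (1 / 2)) * lpLIntegral (4 / 3) g := by
  have := lpLIntegral_lintegral_rieszKernel_le (s := 1 / 2) (by norm_num) (by norm_num) hg
  norm_num at this ⊢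
  exact this

/-- Prepending a coordinate, as a measurable equivalence. -/
noncomputable def consMeasurableEquiv (n : ℕ) : ℂ × (Fin n → ℂ) ≃ᵐ (Fin (n + 1) → ℂ) :=
  (MeasurableEquiv.piFinSuccAbove (fun _ => ℂ) 0).symm

theorem consMeasurableEquiv_apply {n : ℕ} (p : ℂ × (Fin n → ℂ)) :
    consMeasurableEquiv n p = Fin.cons p.1 p.2 := by
  simp [consMeasurableEquiv, MeasurableEquiv.piFinSuccAbove_symm_apply, Fin.insertNthEquiv]

theorem measurePreserving_consMeasurableEquiv (n : ℕ) :
    MeasurePreserving (consMeasurableEquiv n) :=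
  (volume_preserving_piFinSuccAbove (fun _ => ℂ) 0).symm

/-- Appending a coordinate, as a measurable equivalence. -/
noncomputable def snocMeasurableEquiv (n : ℕ) : ℂ × (Fin n → ℂ) ≃ᵐ (Fin (n + 1) → ℂ) :=
  (MeasurableEquiv.piFinSuccAbove (fun _ => ℂ) (Fin.last n)).symm

theorem snocMeasurableEquiv_apply {n : ℕ} (p : ℂ × (Fin n → ℂ)) :
    snocMeasurableEquiv n p = Fin.snoc p.2 p.1 := by
  simp [snocMeasurableEquiv, MeasurableEquiv.piFinSuccAbove_symm_apply, Fin.insertNthEquiv]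

theorem measurePreserving_snocMeasurableEquiv (n : ℕ) :
    MeasurePreserving (snocMeasurableEquiv n) :=
  (volume_preserving_piFinSuccAbove (fun _ => ℂ) (Fin.last n)).symm

theorem lintegral_fin_succ {n : ℕ} {F : (Fin (n + 1) → ℂ) → ℝ≥0∞} (hF : Measurable F) :
    ∫⁻ x, F x = ∫⁻ y : Fin n → ℂ, ∫⁻ a, F (Fin.cons a y : Fin (n + 1) → ℂ) := by
  rw [← (measurePreserving_consMeasurableEquiv n).lintegral_comp hF, Measure.volume_eq_prod]
  refine (lintegral_prod_symm' _ (hF.comp (consMeasurableEquiv n).measurable)).trans ?_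
  simp_rw [Function.comp_apply, consMeasurableEquiv_apply]

theorem lintegral_chain_le {n : ℕ} {P : Fin (n + 1) → ℂ → ℝ≥0∞} (hP : ∀ i, Measurable (P i))
    {H₀ H₁ : ℂ → ℝ≥0∞} (h₀ : Measurable H₀) (h₁ : Measurable H₁) :
    ∫⁻ x : Fin (n + 1) → ℂ, H₀ (x 0) * ((∏ i, P i (x i)) *
        (∏ j : Fin n, rieszKernel (1 / 2) (x j.castSucc) (x j.succ)) * H₁ (x (Fin.last n))) ≤
      ENNReal.ofReal (hlsConst (1 / 2)) ^ n *
        (lpLIntegral 4 H₀ * ((∏ i, lpLIntegral 2 (P i)) * lpLIntegral 4 H₁)) := by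
  have hk := measurable_rieszKernel (1 / 2)
  induction n generalizing H₀ with
  | zero =>
    rw [lintegral_fin_succ (by fun_prop)]
    simp only [Nat.reduceAdd, Fin.cons_zero, Finset.univ_unique, Fin.default_eq_zero, Fin.isValue,
      Finset.prod_singleton, Finset.univ_eq_empty, Finset.prod_empty, mul_one, Fin.last_zero,
      lintegral_const, pow_zero, one_mul]
    have hv : (volume : Measure (Fin 0 → ℂ)) univ = 1 := Measure.pi_empty_univ _
    rw [hv, mul_one]
    calc _ = lpLIntegral 1 (fun a => (H₀ a * H₁ a) * P 0 a) := by
          simp only [lpLIntegral, ENNReal.rpow_one, div_one]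
          exact lintegral_congr fun a => by ring
      _ ≤ lpLIntegral 2 (fun a => H₀ a * H₁ a) * lpLIntegral 2 (P 0) :=
          lpLIntegral_mul_le (by norm_num) (by norm_num) (by norm_num) (by fun_prop) (hP 0)
      _ ≤ lpLIntegral 4 H₀ * lpLIntegral 4 H₁ * lpLIntegral 2 (P 0) := by
          gcongr
          exact lpLIntegral_mul_le (by norm_num) (by norm_num) (by norm_num) h₀ h₁
      _ = _ := by ring
  | succ n ih =>
    have hm : Measurable fun p : ℂ × ℂ => (H₀ p.2 * P 0 p.2) * rieszKernel (1 / 2) p.1 p.2 := by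
      fun_prop
    have hH : Measurable fun w => ∫⁻ a, (H₀ a * P 0 a) * rieszKernel (1 / 2) w a :=
      hm.lintegral_prod_right'
    have hk' : ∀ j : Fin (n + 1), Measurable fun x : Fin (n + 2) → ℂ =>
        rieszKernel (1 / 2) (x j.castSucc) (x j.succ) := by
      intro j
      have h : Measurable fun x : Fin (n + 2) → ℂ => (x j.castSucc, x j.succ) := by fun_prop
      exact hk.comp h
    have hP' : ∀ i, Measurable fun x : Fin (n + 2) → ℂ => P i (x i) := fun i =>
      (hP i).comp (measurable_pi_apply _)
    rw [lintegral_fin_succ (by fun_prop)]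
    calc _ = ∫⁻ y : Fin (n + 1) → ℂ, (∫⁻ a, (H₀ a * P 0 a) * rieszKernel (1 / 2) (y 0) a) *
          ((∏ i, P i.succ (y i)) *
        (∏ j : Fin n, rieszKernel (1 / 2) (y j.castSucc) (y j.succ)) * H₁ (y (Fin.last n))) := by
          refine lintegral_congr fun y => ?_
          refine Eq.trans ?_ (lintegral_mul_const _ (hm.comp (measurable_prodMk_left (x := y 0))))
          refine lintegral_congr fun a => ?_
          rw [Fin.prod_univ_succ (n := n + 1), Fin.prod_univ_succ (fun j : Fin (n + 1) => rieszKernel _ _ _)]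
          simp only [Fin.cons_zero, Fin.cons_succ, Fin.castSucc_zero, ← Fin.succ_castSucc,
            ← Fin.succ_last]
          rw [rieszKernel_comm _ a]
          ring
      _ ≤ _ := by
          refine (ih (fun i => hP i.succ) hH).trans ?_
          have h3 : lpLIntegral 4 (fun w => ∫⁻ a, (H₀ a * P 0 a) * rieszKernel (1 / 2) w a) ≤
              ENNReal.ofReal (hlsConst (1 / 2)) * (lpLIntegral 4 H₀ * lpLIntegral 2 (P 0)) := by
            refine (lpLIntegral_cauchy_le (by fun_prop)).trans ?_
            gcongr
            exact lpLIntegral_mul_le (by norm_num) (by norm_num) (by norm_num) h₀ (hP 0)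
          rw [Fin.prod_univ_succ (fun i => lpLIntegral 2 (P i)), pow_succ]
          calc _ ≤ ENNReal.ofReal (hlsConst (1 / 2)) ^ n *
                ((ENNReal.ofReal (hlsConst (1 / 2)) * (lpLIntegral 4 H₀ * lpLIntegral 2 (P 0))) *
                  ((∏ i : Fin (n + 1), lpLIntegral 2 (P i.succ)) * lpLIntegral 4 H₁)) := by gcongr
            _ = _ := by ring

theorem a1_neg_eq (y z : ℂ) :
    a1 (-y) z = Complex.exp (((-2 * (inner ℝ y z : ℝ) : ℝ) : ℂ) * Complex.I) := by
  unfold a1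
  congr 1
  apply Complex.ext
  · simp [Complex.inner]
  · simp [Complex.inner]
    ring

theorem enorm_a1_neg (y z : ℂ) : ‖a1 (-y) z‖ₑ = 1 := by
  rw [a1_neg_eq, ← ofReal_norm, Complex.norm_exp_ofReal_mul_I, ENNReal.ofReal_one]

open FourierTransform in
theorem integral_a1_mul_eq (g : ℂ → ℂ) (z : ℂ) :
    ∫ y, a1 (-y) z * g y = 𝓕 g (Real.pi⁻¹ • z) := by
  rw [Real.fourier_eq']
  refine integral_congr_ae (Filter.Eventually.of_forall fun y => ?_)
  simp only [a1_neg_eq, smul_eq_mul]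
  congr 4
  rw [inner_smul_right]
  field_simp

open FourierTransform in
theorem eLpNorm_fourier_eq {f : ℂ → ℂ} (h1 : Integrable f) (h2 : MemLp f 2) :
    eLpNorm (𝓕 f) 2 volume = eLpNorm f 2 volume := by
  set u : Lp ℂ 2 (volume : Measure ℂ) := h2.toLp f with hu
  have hloc : LocallyIntegrable (𝓕 f) := by
    refine Continuous.locallyIntegrable ?_
    exact VectorFourier.fourierIntegral_continuous Real.continuous_fourierChar (innerSL ℝ).continuous₂ h1
  have hae : ∀ᵐ x, (𝓕 u : Lp ℂ 2 (volume : Measure ℂ)) x = 𝓕 f x := by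
    refine ae_eq_of_integral_contDiff_smul_eq ((Lp.memLp (𝓕 u : Lp ℂ 2 (volume : Measure ℂ))).locallyIntegrable (by norm_num)) hloc ?_
    intro g hg hgs
    have hgs' : HasCompactSupport (fun x => (g x : ℂ)) := hgs.comp_left (g := fun x : ℝ => (x : ℂ)) (by simp)
    have hg' := (Complex.ofRealCLM.contDiff (n := (⊤ : ℕ∞))).comp hg
    set φ : SchwartzMap ℂ ℂ := hgs'.toSchwartzMap hg' with hφ
    have hφx : ∀ x, φ x = g x := fun x => rfl
    have h3 := congrArg (fun T => T φ) (Lp.fourier_toTemperedDistribution_eq u)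
    simp only [TemperedDistribution.fourier_apply, Lp.toTemperedDistribution_apply] at h3
    have h4 : ∫ x, 𝓕 (φ : ℂ → ℂ) x • f x = ∫ x, φ x • 𝓕 f x := by
      have h5 := VectorFourier.integral_fourierIntegral_smul_eq_flip (L := innerₗ ℂ)
        Real.continuous_fourierChar continuous_inner (φ.integrable (μ := volume)) h1
      rw [flip_innerₗ] at h5
      exact h5
    have h6 : ∫ x, 𝓕 φ x • u x = ∫ x, 𝓕 (φ : ℂ → ℂ) x • f x := by
      refine integral_congr_ae ?_
      filter_upwards [h2.coeFn_toLp] with x hx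
      rw [hu, hx, SchwartzMap.fourier_coe]
    calc _ = ∫ x, φ x • (𝓕 u : Lp ℂ 2 (volume : Measure ℂ)) x := by simp_rw [hφx]; rfl
      _ = ∫ x, φ x • 𝓕 f x := by rw [← h3, h6, h4]
      _ = _ := by simp_rw [hφx]; rfl
  rw [← eLpNorm_congr_ae hae, ← eLpNorm_congr_ae h2.coeFn_toLp]
  have h7 := congrArg ENNReal.ofReal (Lp.norm_fourier_eq u)
  simpa only [Lp.norm_def, ENNReal.ofReal_toReal (Lp.eLpNorm_ne_top _)] using h7

theorem eLpNorm_two_eq_lpLIntegral (f : ℂ → ℂ) :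
    eLpNorm f 2 volume = lpLIntegral 2 (fun x => ‖f x‖ₑ) := by
  simp [eLpNorm_eq_lintegral_rpow_enorm_toReal, lpLIntegral]

theorem lintegral_comp_inv_pi_smul {F : ℂ → ℝ≥0∞} (hF : Measurable F) :
    ∫⁻ z, F (Real.pi⁻¹ • z) = ENNReal.ofReal (Real.pi ^ 2) * ∫⁻ z, F z := by
  have hpi := Real.pi_pos
  rw [← lintegral_map hF (measurable_const_smul _),
    Measure.map_addHaar_smul _ (inv_ne_zero hpi.ne'), lintegral_smul_measure, smul_eq_mul,
    Complex.finrank_real_complex, inv_pow, inv_inv, abs_of_pos (by positivity)]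

theorem lpLIntegral_two_integral_a1_le {g : ℂ → ℂ} (hg : AEStronglyMeasurable g) :
    lpLIntegral 2 (fun z => ‖∫ y, a1 (-y) z * g y‖ₑ) ≤
      ENNReal.ofReal Real.pi * lpLIntegral 2 (fun y => ‖g y‖ₑ) := by
  have hpi := Real.pi_pos
  by_cases h1 : Integrable g
  swap
  · have : ∀ z, ∫ y, a1 (-y) z * g y = 0 := fun z => by
      refine integral_undef fun h => h1 ?_
      refine h.mono hg (Filter.Eventually.of_forall fun y => ?_)
      rw [← enorm_le_iff_norm_le, enorm_mul, enorm_a1_neg, one_mul]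
    simp [this, lpLIntegral]
  by_cases h2 : MemLp g 2
  swap
  · have h3 : lpLIntegral 2 (fun y => ‖g y‖ₑ) = ∞ := by
      rw [← eLpNorm_two_eq_lpLIntegral]
      by_contra h
      exact h2 ⟨hg, lt_top_iff_ne_top.2 h⟩
    rw [h3, ENNReal.mul_top (by simpa using hpi)]
    exact le_top
  have hcont : Continuous (FourierTransform.fourier g) :=
    VectorFourier.fourierIntegral_continuous Real.continuous_fourierChar
      (innerSL ℝ).continuous₂ h1
  rw [← eLpNorm_two_eq_lpLIntegral g, ← eLpNorm_fourier_eq h1 h2, eLpNorm_two_eq_lpLIntegral]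
  simp_rw [integral_a1_mul_eq]
  unfold lpLIntegral
  rw [lintegral_comp_inv_pi_smul (F := fun z => ‖FourierTransform.fourier g z‖ₑ ^ (2 : ℝ))
    (hcont.measurable.enorm.pow_const _), ENNReal.mul_rpow_of_nonneg _ _ (by norm_num),
    ENNReal.ofReal_rpow_of_nonneg (by positivity) (by norm_num), ← Real.sqrt_eq_rpow,
    Real.sqrt_sq hpi.le]

theorem lintegral_rpow_autoconvolution_le {g : ℂ → ℝ≥0∞} (hg : Measurable g) :
    ∫⁻ w, (∫⁻ t, g t * g (w - t)) ^ (2 : ℝ) ≤ (∫⁻ t, g t ^ (4 / 3 : ℝ)) ^ (3 : ℝ) := by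
  set N := ∫⁻ t, g t ^ (4 / 3 : ℝ) with hN
  have htr : ∀ w, ∫⁻ t, g (w - t) ^ (4 / 3 : ℝ) = N := fun w =>
    lintegral_sub_left_eq_self (fun t => g t ^ (4 / 3 : ℝ)) w
  have hpt : ∀ w, (∫⁻ t, g t * g (w - t)) ^ (2 : ℝ) ≤
      (∫⁻ t, g t ^ (4 / 3 : ℝ) * g (w - t) ^ (4 / 3 : ℝ)) * N := by
    intro w
    have hgw : Measurable fun t => g (w - t) := by fun_prop
    have hsplit : ∀ x : ℝ≥0∞, x = x ^ (2 / 3 : ℝ) * x ^ (1 / 3 : ℝ) := fun x => by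
      rw [← ENNReal.rpow_add_of_nonneg _ _ (by norm_num) (by norm_num)]
      norm_num
    have e1 : lpLIntegral 1 (fun t => (g t ^ (2 / 3 : ℝ) * g (w - t) ^ (2 / 3 : ℝ)) *
        (g t ^ (1 / 3 : ℝ) * g (w - t) ^ (1 / 3 : ℝ))) = ∫⁻ t, g t * g (w - t) := by
      simp only [lpLIntegral, ENNReal.rpow_one, div_one]
      refine lintegral_congr fun t => ?_
      conv_rhs => rw [hsplit (g t), hsplit (g (w - t))]
      ring
    have e2 : ∀ {f : ℂ → ℝ≥0∞}, lpLIntegral 2 f ^ (2 : ℝ) = ∫⁻ t, f t ^ (2 : ℝ) := fun {f} => by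
      rw [lpLIntegral, ← ENNReal.rpow_mul]
      norm_num
    have e3 : lpLIntegral 2 (fun t => g t ^ (1 / 3 : ℝ) * g (w - t) ^ (1 / 3 : ℝ)) ^ (2 : ℝ) ≤
        N := by
      have := lpLIntegral_mul_le (p := 2) (q := 4) (r := 4) (by norm_num) (by norm_num)
        (by norm_num) (hg.pow_const (1 / 3 : ℝ)) (hgw.pow_const (1 / 3 : ℝ))
      refine (ENNReal.rpow_le_rpow this (by norm_num : (0 : ℝ) ≤ 2)).trans_eq ?_
      have e4 : ∀ x : ℝ≥0∞, (x ^ (1 / 3 : ℝ)) ^ (4 : ℝ) = x ^ (4 / 3 : ℝ) := fun x => by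
        rw [← ENNReal.rpow_mul]; norm_num
      simp only [lpLIntegral, e4, htr, ← hN]
      rw [← ENNReal.rpow_add_of_nonneg _ _ (by norm_num) (by norm_num), ← ENNReal.rpow_mul]
      norm_num
    have := lpLIntegral_mul_le (p := 1) (q := 2) (r := 2) (by norm_num) (by norm_num)
      (by norm_num) ((hg.pow_const (2 / 3 : ℝ)).mul (hgw.pow_const (2 / 3 : ℝ)))
      ((hg.pow_const (1 / 3 : ℝ)).mul (hgw.pow_const (1 / 3 : ℝ)))
    refine (ENNReal.rpow_le_rpow (e1.symm.trans_le this) (by norm_num : (0 : ℝ) ≤ 2)).trans ?_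
    rw [ENNReal.mul_rpow_of_nonneg _ _ (by norm_num), e2]
    refine mul_le_mul' (le_of_eq ?_) e3
    refine lintegral_congr fun t => ?_
    have e5 : ∀ x : ℝ≥0∞, (x ^ (2 / 3 : ℝ)) ^ (2 : ℝ) = x ^ (4 / 3 : ℝ) := fun x => by
      rw [← ENNReal.rpow_mul]; norm_num
    rw [Pi.mul_apply, ENNReal.mul_rpow_of_nonneg _ _ (by norm_num), e5, e5]
  have hm : Measurable fun p : ℂ × ℂ => g p.2 ^ (4 / 3 : ℝ) * g (p.1 - p.2) ^ (4 / 3 : ℝ) := by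
    fun_prop
  have hmI : Measurable fun w => ∫⁻ t, g t ^ (4 / 3 : ℝ) * g (w - t) ^ (4 / 3 : ℝ) :=
    hm.lintegral_prod_right'
  refine (lintegral_mono hpt).trans_eq ?_
  rw [lintegral_mul_const _ hmI,
    lintegral_lintegral_swap (f := fun w t => g t ^ (4 / 3 : ℝ) * g (w - t) ^ (4 / 3 : ℝ))
      hm.aemeasurable]
  have e6 : ∀ t, ∫⁻ w, g t ^ (4 / 3 : ℝ) * g (w - t) ^ (4 / 3 : ℝ) = g t ^ (4 / 3 : ℝ) * N := by
    intro t
    rw [lintegral_const_mul _ (by fun_prop)]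
    congr 1
    exact lintegral_sub_right_eq_self (fun t => g t ^ (4 / 3 : ℝ)) t
  simp_rw [e6]
  rw [lintegral_mul_const _ (by fun_prop), ← hN, show (3 : ℝ) = (3 : ℕ) by norm_num,
    ENNReal.rpow_natCast]
  ring

/-- A Hausdorff--Young inequality from `L^(4/3)` to `L⁴`. -/
theorem lintegral_rpow_integral_a1_le {g : ℂ → ℂ} (hg : Measurable g) :
    ∫⁻ z, ‖∫ y, a1 (-y) z * g y‖ₑ ^ (4 : ℝ) ≤
      ENNReal.ofReal Real.pi ^ (2 : ℝ) * (∫⁻ y, ‖g y‖ₑ ^ (4 / 3 : ℝ)) ^ (3 : ℝ) := by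
  by_cases h1 : Integrable g
  swap
  · have : ∀ z, ∫ y, a1 (-y) z * g y = 0 := fun z => by
      refine integral_undef fun h => h1 ?_
      refine h.mono hg.aestronglyMeasurable (Filter.Eventually.of_forall fun y => ?_)
      rw [← enorm_le_iff_norm_le, enorm_mul, enorm_a1_neg, one_mul]
    simp [this]
  set c : ℂ → ℂ := fun w => ∫ t, g t * g (w - t) with hc
  have hcs : AEStronglyMeasurable c :=
    (h1.integrable_convolution (ContinuousLinearMap.mul ℂ ℂ) h1).aestronglyMeasurable
  have hsq : ∀ z, ∫ y, a1 (-y) z * c y = (∫ y, a1 (-y) z * g y) ^ 2 := fun z => by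
    rw [integral_a1_mul_eq, integral_a1_mul_eq, sq]
    exact Real.fourier_mul_convolution_eq h1 h1 _
  have e2 : ∀ {f : ℂ → ℝ≥0∞}, lpLIntegral 2 f ^ (2 : ℝ) = ∫⁻ t, f t ^ (2 : ℝ) := fun {f} => by
    rw [lpLIntegral, ← ENNReal.rpow_mul]
    norm_num
  have h2 := ENNReal.rpow_le_rpow (lpLIntegral_two_integral_a1_le hcs) (by norm_num : (0 : ℝ) ≤ 2)
  rw [ENNReal.mul_rpow_of_nonneg _ _ (by norm_num), e2, e2] at h2
  calc _ = ∫⁻ z, ‖∫ y, a1 (-y) z * c y‖ₑ ^ (2 : ℝ) := by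
        refine lintegral_congr fun z => ?_
        rw [hsq, enorm_pow, ← ENNReal.rpow_natCast, ← ENNReal.rpow_mul]
        norm_num
    _ ≤ _ := h2
    _ ≤ _ := by
        gcongr
        refine le_trans ?_ (lintegral_rpow_autoconvolution_le hg.enorm)
        refine lintegral_mono fun w => ?_
        dsimp only
        gcongr
        refine (enorm_integral_le_lintegral_enorm _).trans_eq ?_
        simp_rw [enorm_mul]

theorem rieszKernel_half_rpow (x y : ℂ) :
    rieszKernel (1 / 2) x y ^ (4 / 3 : ℝ) = rieszKernel (1 / 3) x y := by
  unfold rieszKernel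
  rw [ENNReal.ofReal_rpow_of_nonneg (by positivity) (by norm_num), ← Real.rpow_mul (norm_nonneg _)]
  norm_num

theorem continuous_a1_uncurry : Continuous fun q : ℂ × ℂ => a1 q.1 q.2 := by
  unfold a1
  fun_prop

/-- The oscillatory integral over an endpoint variable, as a function of its neighbour `x` and of
the frequency `z`. -/
noncomputable def endFactor (κ : ℂ → ℂ → ℂ) (p : ℂ → ℂ) (x z : ℂ) : ℂ :=
  ∫ y, a1 (-y) z * (p y * κ x y)

theorem measurable_endFactor {κ : ℂ → ℂ → ℂ} (hκ : Measurable fun q : ℂ × ℂ => κ q.1 q.2)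
    {p : ℂ → ℂ} (hp : Measurable p) : Measurable fun q : ℂ × ℂ => endFactor κ p q.1 q.2 := by
  have ha : Measurable fun r : (ℂ × ℂ) × ℂ => a1 (-r.2) r.1.2 :=
    (continuous_a1_uncurry.comp (by fun_prop : Continuous fun r : (ℂ × ℂ) × ℂ =>
      (-r.2, r.1.2))).measurable
  have hk : Measurable fun r : (ℂ × ℂ) × ℂ => κ r.1.1 r.2 :=
    hκ.comp (by fun_prop : Measurable fun r : (ℂ × ℂ) × ℂ => (r.1.1, r.2))
  have hm : Measurable fun r : (ℂ × ℂ) × ℂ => a1 (-r.2) r.1.2 * (p r.2 * κ r.1.1 r.2) := by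
    fun_prop
  exact (hm.stronglyMeasurable.integral_prod_right').measurable

/-- The constant in the mixed-norm bound for `endFactor`. -/
noncomputable def endConst : ℝ≥0∞ :=
  (ENNReal.ofReal Real.pi ^ (2 : ℝ) * ENNReal.ofReal (hlsConst (1 / 3)) ^ (3 : ℝ)) ^ (1 / 4 : ℝ)

theorem endConst_ne_top : endConst ≠ ∞ := by
  refine ENNReal.rpow_ne_top_of_nonneg (by norm_num) (ENNReal.mul_ne_top ?_ ?_) <;>
    exact ENNReal.rpow_ne_top_of_nonneg (by norm_num) ENNReal.ofReal_ne_top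

theorem lpLIntegral_endFactor_le {κ : ℂ → ℂ → ℂ} (hκ : Measurable fun q : ℂ × ℂ => κ q.1 q.2)
    (hκ' : ∀ x y, ‖κ x y‖ₑ ≤ rieszKernel (1 / 2) x y) {p : ℂ → ℂ} (hp : Measurable p) :
    lpLIntegral 4 (fun z => lpLIntegral 4 fun x => ‖endFactor κ p x z‖ₑ) ≤
      endConst * lpLIntegral 2 fun y => ‖p y‖ₑ := by
  have hm := measurable_endFactor hκ hp
  have hk3 := measurable_rieszKernel (1 / 3)
  have key : ∫⁻ z, ∫⁻ x, ‖endFactor κ p x z‖ₑ ^ (4 : ℝ) ≤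
      ENNReal.ofReal Real.pi ^ (2 : ℝ) * ENNReal.ofReal (hlsConst (1 / 3)) ^ (3 : ℝ) *
        (∫⁻ y, ‖p y‖ₑ ^ (2 : ℝ)) ^ (2 : ℝ) := by
    rw [lintegral_lintegral_swap (f := fun z x => ‖endFactor κ p x z‖ₑ ^ (4 : ℝ))
      ((hm.comp measurable_swap).enorm.pow_const _).aemeasurable]
    have hI : Measurable fun x => ∫⁻ y, ‖p y‖ₑ ^ (4 / 3 : ℝ) * rieszKernel (1 / 3) x y := by
      have : Measurable fun q : ℂ × ℂ => ‖p q.2‖ₑ ^ (4 / 3 : ℝ) * rieszKernel (1 / 3) q.1 q.2 := by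
        fun_prop
      exact this.lintegral_prod_right'
    calc _ ≤ ∫⁻ x, ENNReal.ofReal Real.pi ^ (2 : ℝ) *
          (∫⁻ y, ‖p y‖ₑ ^ (4 / 3 : ℝ) * rieszKernel (1 / 3) x y) ^ (3 : ℝ) := by
          refine lintegral_mono fun x => ?_
          have hx : Measurable fun y => κ x y := hκ.comp measurable_prodMk_left
          refine (lintegral_rpow_integral_a1_le (g := fun y => p y * κ x y) (by fun_prop)).trans ?_
          gcongr with y
          rw [enorm_mul, ENNReal.mul_rpow_of_nonneg _ _ (by norm_num), ← rieszKernel_half_rpow]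
          gcongr
          exact hκ' x y
      _ ≤ ENNReal.ofReal Real.pi ^ (2 : ℝ) * (ENNReal.ofReal (hlsConst (1 / 3)) *
          (∫⁻ y, ‖p y‖ₑ ^ (2 : ℝ)) ^ (2 / 3 : ℝ)) ^ (3 : ℝ) := by
          rw [lintegral_const_mul _ (hI.pow_const _)]
          gcongr
          have := lintegral_rpow_lintegral_rieszKernel_le (s := 1 / 3) (by norm_num) (by norm_num)
            (hp.enorm.pow_const (4 / 3 : ℝ))
          have e : ∀ y, (‖p y‖ₑ ^ (4 / 3 : ℝ)) ^ (3 / 2 : ℝ) = ‖p y‖ₑ ^ (2 : ℝ) := fun y => by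
            rw [← ENNReal.rpow_mul]; norm_num
          rw [show (2 : ℝ) / (1 - 1 / 3) = 3 by norm_num,
            show (2 : ℝ) / (1 + 1 / 3) = 3 / 2 by norm_num,
            show ((1 : ℝ) + 1 / 3) / 2 = 2 / 3 by norm_num] at this
          simp_rw [e] at this
          exact this
      _ = _ := by
          rw [ENNReal.mul_rpow_of_nonneg _ _ (by norm_num), ← ENNReal.rpow_mul, mul_assoc]
          norm_num
  have e4 : ∀ f : ℂ → ℝ≥0∞, lpLIntegral 4 f ^ (4 : ℝ) = ∫⁻ t, f t ^ (4 : ℝ) := fun f => by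
    rw [lpLIntegral, ← ENNReal.rpow_mul]
    norm_num
  calc _ = (∫⁻ z, ∫⁻ x, ‖endFactor κ p x z‖ₑ ^ (4 : ℝ)) ^ (1 / 4 : ℝ) := by
        conv_lhs => rw [lpLIntegral]
        simp_rw [e4]
    _ ≤ _ := ENNReal.rpow_le_rpow key (by norm_num)
    _ = _ := by
        rw [ENNReal.mul_rpow_of_nonneg _ _ (by norm_num), endConst, ← ENNReal.rpow_mul, lpLIntegral]
        norm_num

/-- The `j`-th Cauchy factor, conjugated for even `j`. -/
noncomputable def cauchyFactor (j : ℕ) (x y : ℂ) : ℂ :=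
  if j % 2 = 0 then (starRingEnd ℂ) x - (starRingEnd ℂ) y else x - y

theorem cauchyDen_eq_prod {n : ℕ} (x : Fin (n + 1) → ℂ) :
    cauchyDen x = ∏ j : Fin n, cauchyFactor j (x j.castSucc) (x j.succ) := rfl

theorem enorm_inv_cauchyFactor (j : ℕ) (x y : ℂ) :
    ‖(cauchyFactor j x y)⁻¹‖ₑ = rieszKernel (1 / 2) x y := by
  have h : ‖cauchyFactor j x y‖ = ‖x - y‖ := by
    unfold cauchyFactor
    split_ifs
    · rw [← map_sub, RCLike.norm_conj]
    · rfl
  rw [← ofReal_norm, norm_inv, h, rieszKernel, show -(2 - 2 * (1 / 2 : ℝ)) = -1 by norm_num,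
    Real.rpow_neg_one]

theorem measurable_inv_cauchyFactor (j : ℕ) :
    Measurable fun q : ℂ × ℂ => (cauchyFactor j q.1 q.2)⁻¹ := by
  unfold cauchyFactor
  have h : Measurable (starRingEnd ℂ) := Complex.continuous_conj.measurable
  split_ifs <;> fun_prop

theorem a1_add (x y z : ℂ) : a1 (x + y) z = a1 x z * a1 y z := by
  unfold a1
  rw [← Complex.exp_add, map_add]
  congr 1
  ring

theorem enorm_a1 (x z : ℂ) : ‖a1 x z‖ₑ = 1 := by
  rw [← neg_neg x]
  exact enorm_a1_neg _ _

/-- The integrand of the multilinear form obtained by polarising `Sk12`. -/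
noncomputable def chainIntegrand {n : ℕ} (p : Fin (n + 1) → ℂ → ℂ) (z : ℂ) (x : Fin (n + 1) → ℂ) :
    ℂ :=
  a1 (-altSum x) z * (∏ i, p i (x i)) / cauchyDen x

/-- The factor of `chainIntegrand` that does not involve the endpoint variables. -/
noncomputable def innerIntegrand {l : ℕ} (p : Fin (2 * l + 3) → ℂ → ℂ) (z : ℂ)
    (y : Fin (2 * l + 1) → ℂ) : ℂ :=
  a1 (altSum y) z * (∏ i : Fin (2 * l + 1), p i.castSucc.succ (y i)) *
    ∏ j : Fin (2 * l), (cauchyFactor (j + 1) (y j.castSucc) (y j.succ))⁻¹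

theorem altSum_cons_snoc {l : ℕ} (a b : ℂ) (y : Fin (2 * l + 1) → ℂ) :
    altSum (Fin.cons a (Fin.snoc y b : Fin (2 * l + 2) → ℂ) : Fin (2 * l + 3) → ℂ) =
      a - altSum y + b := by
  unfold altSum
  rw [Fin.sum_univ_succ, Fin.sum_univ_castSucc]
  simp only [Fin.val_zero, pow_zero, one_mul, Fin.cons_zero, Fin.cons_succ, Fin.val_succ,
    Fin.val_castSucc, Fin.snoc_castSucc, Fin.snoc_last, Fin.val_last, pow_succ, pow_mul]
  simp only [mul_neg, mul_one, neg_mul, Finset.sum_neg_distrib]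
  simp
  ring

theorem chainIntegrand_cons_snoc {l : ℕ} (p : Fin (2 * l + 3) → ℂ → ℂ) (z a b : ℂ)
    (y : Fin (2 * l + 1) → ℂ) :
    chainIntegrand p z (Fin.cons a (Fin.snoc y b : Fin (2 * l + 2) → ℂ) : Fin (2 * l + 3) → ℂ) =
      (a1 (-a) z * (p 0 a * (cauchyFactor 0 a (y 0))⁻¹)) *
        (a1 (-b) z * (p (Fin.last _) b * (cauchyFactor (2 * l + 1) (y (Fin.last _)) b)⁻¹)) *
          innerIntegrand p z y := by
  set Y : Fin (2 * l + 2) → ℂ := Fin.snoc y b with hY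
  have hYc : ∀ i : Fin (2 * l + 1), Y i.castSucc = y i := fun i =>
    Fin.snoc_castSucc (α := fun _ => ℂ) b y i
  have hYl : Y (Fin.last _) = b := Fin.snoc_last (α := fun _ => ℂ) b y
  have h0 : Y 0 = y 0 := hYc 0
  have h1 : ∀ j : Fin (2 * l), Y j.castSucc.succ = y j.succ := fun j => by
    rw [Fin.succ_castSucc, hYc]
  have h2 : Y (Fin.last (2 * l)).succ = b := by rw [Fin.succ_last, hYl]
  have h3 : ∀ j : Fin (2 * l + 1), (Fin.cons a Y : Fin (2 * l + 3) → ℂ) j.succ.castSucc = y j :=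
    fun j => by rw [← Fin.succ_castSucc, Fin.cons_succ, hYc]
  have h4 : p (Fin.last (2 * l + 1)).succ = p (Fin.last _) := by rw [Fin.succ_last]
  have e1 : a1 (-(a - altSum y + b)) z = a1 (-a) z * a1 (-b) z * a1 (altSum y) z := by
    rw [← a1_add, ← a1_add]
    congr 1
    ring
  unfold chainIntegrand innerIntegrand
  rw [altSum_cons_snoc, e1, cauchyDen_eq_prod, Fin.prod_univ_succ (n := 2 * l + 2),
    Fin.prod_univ_castSucc (n := 2 * l + 1),
    Fin.prod_univ_succ (fun j : Fin (2 * l + 2) => cauchyFactor _ _ _),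
    Fin.prod_univ_castSucc (fun j : Fin (2 * l + 1) => cauchyFactor _ _ _)]
  simp only [Fin.cons_zero, Fin.cons_succ, Fin.castSucc_zero, Fin.val_zero, Fin.val_succ,
    Fin.val_castSucc, Fin.val_last, h0, h1, h2, h3, h4, hYc, hYl, Finset.prod_inv_distrib,
    div_eq_mul_inv, mul_inv]
  ring

/-- Adjoining a first and a last coordinate, as a measurable equivalence. -/
noncomputable def endsMeasurableEquiv (n : ℕ) : (ℂ × ℂ) × (Fin n → ℂ) ≃ᵐ (Fin (n + 2) → ℂ) :=
  (MeasurableEquiv.prodAssoc.trans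
    ((MeasurableEquiv.refl ℂ).prodCongr (snocMeasurableEquiv n))).trans (consMeasurableEquiv (n + 1))

theorem endsMeasurableEquiv_apply {n : ℕ} (a b : ℂ) (y : Fin n → ℂ) :
    endsMeasurableEquiv n ((a, b), y) =
      (Fin.cons a (Fin.snoc y b : Fin (n + 1) → ℂ) : Fin (n + 2) → ℂ) := by
  have : endsMeasurableEquiv n ((a, b), y) =
    consMeasurableEquiv (n + 1) (a, snocMeasurableEquiv n (b, y)) := rfl
  rw [this, snocMeasurableEquiv_apply, consMeasurableEquiv_apply]

theorem measurePreserving_endsMeasurableEquiv (n : ℕ) :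
    MeasurePreserving (endsMeasurableEquiv n) :=
  (measurePreserving_consMeasurableEquiv (n + 1)).comp
    (((MeasurePreserving.id volume).prod (measurePreserving_snocMeasurableEquiv n)).comp
      volume_preserving_prodAssoc)

theorem continuous_altSum {n : ℕ} : Continuous fun x : Fin n → ℂ => altSum x := by
  unfold altSum
  fun_prop

theorem measurable_chainIntegrand {n : ℕ} {p : Fin (n + 1) → ℂ → ℂ} (hp : ∀ i, Measurable (p i)) :
    Measurable fun q : ℂ × (Fin (n + 1) → ℂ) => chainIntegrand p q.1 q.2 := by
  have h1 : Measurable fun q : ℂ × (Fin (n + 1) → ℂ) => a1 (-altSum q.2) q.1 := by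
    have h : Continuous fun q : ℂ × (Fin (n + 1) → ℂ) => (-altSum q.2, q.1) :=
      (continuous_altSum.comp continuous_snd).neg.prodMk continuous_fst
    exact (continuous_a1_uncurry.comp h).measurable
  have h2 : Measurable fun q : ℂ × (Fin (n + 1) → ℂ) => ∏ i, p i (q.2 i) := by
    refine Finset.measurable_prod _ fun i _ => ?_
    have h : Measurable fun q : ℂ × (Fin (n + 1) → ℂ) => q.2 i := by fun_prop
    exact (hp i).comp h
  have h3 : Measurable fun q : ℂ × (Fin (n + 1) → ℂ) =>
      ∏ j : Fin n, (cauchyFactor j (q.2 j.castSucc) (q.2 j.succ))⁻¹ := by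
    refine Finset.measurable_prod _ fun j _ => ?_
    have h : Measurable fun q : ℂ × (Fin (n + 1) → ℂ) => (q.2 j.castSucc, q.2 j.succ) := by
      fun_prop
    have h' := (measurable_inv_cauchyFactor j).comp h
    have e : (fun q : ℂ × (Fin (n + 1) → ℂ) =>
        (cauchyFactor j (q.2 j.castSucc) (q.2 j.succ))⁻¹) =
      (fun q : ℂ × ℂ => (cauchyFactor j q.1 q.2)⁻¹) ∘ fun q => (q.2 j.castSucc, q.2 j.succ) := rfl
    rw [e]
    exact h'
  have e : ∀ q : ℂ × (Fin (n + 1) → ℂ), chainIntegrand p q.1 q.2 =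
      a1 (-altSum q.2) q.1 * (∏ i, p i (q.2 i)) *
        ∏ j : Fin n, (cauchyFactor j (q.2 j.castSucc) (q.2 j.succ))⁻¹ := fun q => by
    rw [chainIntegrand, cauchyDen_eq_prod, div_eq_mul_inv, Finset.prod_inv_distrib]
  simp_rw [e]
  exact (h1.mul h2).mul h3

theorem enorm_innerIntegrand {l : ℕ} (p : Fin (2 * l + 3) → ℂ → ℂ) (z : ℂ)
    (y : Fin (2 * l + 1) → ℂ) :
    ‖innerIntegrand p z y‖ₑ = (∏ i : Fin (2 * l + 1), ‖p i.castSucc.succ (y i)‖ₑ) *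
      ∏ j : Fin (2 * l), rieszKernel (1 / 2) (y j.castSucc) (y j.succ) := by
  have h : ∀ {m : ℕ} (f : Fin m → ℂ), ‖∏ i, f i‖ₑ = ∏ i, ‖f i‖ₑ := fun f => by
    simp only [enorm, nnnorm_prod, ENNReal.ofNNReal_finsetProd]
  rw [innerIntegrand, enorm_mul, enorm_mul, enorm_a1, one_mul, h, h]
  simp_rw [enorm_inv_cauchyFactor]

theorem lintegral_enorm_chainIntegrand_le {l : ℕ} {p : Fin (2 * l + 3) → ℂ → ℂ}
    (hp : ∀ i, Measurable (p i)) (z : ℂ) :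
    ∫⁻ x, ‖chainIntegrand p z x‖ₑ ≤ ENNReal.ofReal (hlsConst (1 / 2)) ^ (2 * l) *
      ((ENNReal.ofReal (hlsConst (1 / 2)) * lpLIntegral (4 / 3) fun y => ‖p 0 y‖ₑ) *
        ((∏ i : Fin (2 * l + 1), lpLIntegral 2 fun y => ‖p i.castSucc.succ y‖ₑ) *
          (ENNReal.ofReal (hlsConst (1 / 2)) *
            lpLIntegral (4 / 3) fun y => ‖p (Fin.last _) y‖ₑ))) := by
  have hk := measurable_rieszKernel (1 / 2)
  have hm := measurable_chainIntegrand hp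
  have hms : ∀ i, Measurable fun q : ℂ × ℂ => ‖p i q.2‖ₑ * rieszKernel (1 / 2) q.1 q.2 :=
    fun i => by
      have := hp i
      fun_prop
  have hH : ∀ i, Measurable fun w => ∫⁻ a, ‖p i a‖ₑ * rieszKernel (1 / 2) w a := fun i =>
    (hms i).lintegral_prod_right'
  have hF : Measurable fun x => ‖chainIntegrand p z x‖ₑ :=
    (hm.comp (measurable_prodMk_left (x := z))).enorm
  calc _ = ∫⁻ y : Fin (2 * l + 1) → ℂ, (∫⁻ a, ‖p 0 a‖ₑ * rieszKernel (1 / 2) (y 0) a) *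
        ((∏ i : Fin (2 * l + 1), ‖p i.castSucc.succ (y i)‖ₑ) *
          (∏ j : Fin (2 * l), rieszKernel (1 / 2) (y j.castSucc) (y j.succ)) *
          ∫⁻ b, ‖p (Fin.last _) b‖ₑ * rieszKernel (1 / 2) (y (Fin.last _)) b) := by
        rw [← (measurePreserving_endsMeasurableEquiv (2 * l + 1)).lintegral_comp hF,
          Measure.volume_eq_prod]
        refine (lintegral_prod_symm' _
          (hF.comp (endsMeasurableEquiv (2 * l + 1)).measurable)).trans ?_
        refine lintegral_congr fun y => ?_
        have e : ∀ q : ℂ × ℂ, ‖chainIntegrand p z (endsMeasurableEquiv (2 * l + 1) (q, y))‖ₑ =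
            (‖p 0 q.1‖ₑ * rieszKernel (1 / 2) (y 0) q.1) *
            (‖p (Fin.last _) q.2‖ₑ * rieszKernel (1 / 2) (y (Fin.last _)) q.2) *
              ‖innerIntegrand p z y‖ₑ := by
          rintro ⟨a, b⟩
          rw [endsMeasurableEquiv_apply, chainIntegrand_cons_snoc]
          simp only [enorm_mul, enorm_a1_neg, enorm_inv_cauchyFactor, one_mul]
          rw [rieszKernel_comm _ a]
        have m0 : Measurable fun a => ‖p 0 a‖ₑ * rieszKernel (1 / 2) (y 0) a :=
          (hms 0).comp measurable_prodMk_left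
        have m1 : Measurable fun a =>
            ‖p (Fin.last _) a‖ₑ * rieszKernel (1 / 2) (y (Fin.last _)) a :=
          (hms (Fin.last _)).comp measurable_prodMk_left
        simp_rw [Function.comp_apply, e]
        rw [lintegral_mul_const _ (by fun_prop), Measure.volume_eq_prod,
          lintegral_prod_mul m0.aemeasurable m1.aemeasurable, enorm_innerIntegrand]
        ring
    _ ≤ _ := by
        refine (lintegral_chain_le (P := fun i y => ‖p i.castSucc.succ y‖ₑ)
          (fun i => (hp _).enorm) (hH 0) (hH (Fin.last _))).trans ?_
        gcongr
        · exact lpLIntegral_cauchy_le (hp _).enorm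
        · exact lpLIntegral_cauchy_le (hp _).enorm

theorem enorm_integral_chainIntegrand_le {l : ℕ} {p : Fin (2 * l + 3) → ℂ → ℂ}
    (hp : ∀ i, Measurable (p i)) (z : ℂ) :
    ‖∫ x, chainIntegrand p z x‖ₑ ≤ ENNReal.ofReal (hlsConst (1 / 2)) ^ (2 * l) *
      (lpLIntegral 4 (fun w =>
          ‖endFactor (fun x y => (cauchyFactor 0 y x)⁻¹) (p 0) w z‖ₑ) *
        ((∏ i : Fin (2 * l + 1), lpLIntegral 2 fun y => ‖p i.castSucc.succ y‖ₑ) *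
          lpLIntegral 4 (fun w => ‖endFactor (fun x y => (cauchyFactor (2 * l + 1) x y)⁻¹)
            (p (Fin.last _)) w z‖ₑ))) := by
  by_cases hi : Integrable (chainIntegrand p z)
  swap
  · rw [integral_undef hi, enorm_zero]
    exact zero_le
  have hE := measurePreserving_endsMeasurableEquiv (2 * l + 1)
  have m0 := measurable_endFactor (κ := fun x y => (cauchyFactor 0 y x)⁻¹)
    ((measurable_inv_cauchyFactor 0).comp measurable_swap) (hp 0)
  have m1 := measurable_endFactor (κ := fun x y => (cauchyFactor (2 * l + 1) x y)⁻¹)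
    (measurable_inv_cauchyFactor (2 * l + 1)) (hp (Fin.last _))
  have hi' := (hE.integrable_comp_emb (endsMeasurableEquiv (2 * l + 1)).measurableEmbedding).2 hi
  rw [← hE.integral_comp' (chainIntegrand p z)]
  refine (congrArg _ (integral_prod_symm _ hi')).trans_le ?_
  refine (enorm_integral_le_lintegral_enorm _).trans ?_
  refine le_of_eq_of_le (lintegral_congr fun y => ?_)
    (lintegral_chain_le (P := fun i y => ‖p i.castSucc.succ y‖ₑ) (fun i => (hp _).enorm)
      (m0.comp measurable_prodMk_right).enorm (m1.comp measurable_prodMk_right).enorm)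
  have e : ∀ q : ℂ × ℂ, chainIntegrand p z (endsMeasurableEquiv (2 * l + 1) (q, y)) =
      (a1 (-q.1) z * (p 0 q.1 * (cauchyFactor 0 q.1 (y 0))⁻¹)) *
        (a1 (-q.2) z * (p (Fin.last _) q.2 *
          (cauchyFactor (2 * l + 1) (y (Fin.last _)) q.2)⁻¹)) * innerIntegrand p z y := by
    rintro ⟨a, b⟩
    rw [endsMeasurableEquiv_apply, chainIntegrand_cons_snoc]
  simp_rw [Function.comp_apply, e]
  rw [integral_mul_const, Measure.volume_eq_prod,
    integral_prod_mul (fun a => a1 (-a) z * (p 0 a * (cauchyFactor 0 a (y 0))⁻¹))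
      (fun b => a1 (-b) z * (p (Fin.last _) b *
          (cauchyFactor (2 * l + 1) (y (Fin.last _)) b)⁻¹)),
    enorm_mul, enorm_mul, enorm_innerIntegrand]
  simp only [endFactor]
  ring

theorem measurable_lpLIntegral_right {α β : Type*} [MeasureSpace α] [MeasurableSpace β]
    [SFinite (volume : Measure α)] {p : ℝ} {f : α → β → ℝ≥0∞}
    (hf : Measurable fun q : α × β => f q.1 q.2) :
    Measurable fun b => lpLIntegral p fun a => f a b := by
  have h : Measurable fun q : β × α => f q.2 q.1 ^ p := (hf.comp measurable_swap).pow_const p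
  exact h.lintegral_prod_right'.pow_const _

theorem lpLIntegral_const_mul {α : Type*} [MeasureSpace α] {p : ℝ} (hp : 0 < p) (c : ℝ≥0∞)
    {f : α → ℝ≥0∞} (hf : Measurable f) :
    lpLIntegral p (fun x => c * f x) = c * lpLIntegral p f := by
  have e : ∫⁻ x, c ^ p * f x ^ p = c ^ p * ∫⁻ x, f x ^ p :=
    lintegral_const_mul _ (hf.pow_const p)
  simp only [lpLIntegral, ENNReal.mul_rpow_of_nonneg _ _ hp.le]
  rw [e, ENNReal.mul_rpow_of_nonneg _ _ (by positivity), ← ENNReal.rpow_mul,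
    mul_one_div_cancel hp.ne', ENNReal.rpow_one]

theorem lpLIntegral_mono {α : Type*} [MeasureSpace α] {p : ℝ} (hp : 0 < p)
    {f g : α → ℝ≥0∞} (h : ∀ x, f x ≤ g x) : lpLIntegral p f ≤ lpLIntegral p g := by
  unfold lpLIntegral
  gcongr
  exact h _

theorem lpLIntegral_two_integral_chainIntegrand_le {l : ℕ} {p : Fin (2 * l + 3) → ℂ → ℂ}
    (hp : ∀ i, Measurable (p i)) :
    lpLIntegral 2 (fun z => ‖∫ x, chainIntegrand p z x‖ₑ) ≤
      endConst ^ 2 * ENNReal.ofReal (hlsConst (1 / 2)) ^ (2 * l) *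
        ∏ i, lpLIntegral 2 fun y => ‖p i y‖ₑ := by
  have h0 : ∀ x y, ‖(cauchyFactor 0 y x)⁻¹‖ₑ ≤ rieszKernel (1 / 2) x y := fun x y => by
    rw [enorm_inv_cauchyFactor, rieszKernel_comm]
  have h1 : ∀ x y, ‖(cauchyFactor (2 * l + 1) x y)⁻¹‖ₑ ≤ rieszKernel (1 / 2) x y := fun x y => by
    rw [enorm_inv_cauchyFactor]
  have k0 : Measurable fun q : ℂ × ℂ => (cauchyFactor 0 q.2 q.1)⁻¹ :=
    (measurable_inv_cauchyFactor 0).comp measurable_swap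
  have k1 := measurable_inv_cauchyFactor (2 * l + 1)
  have m0 := measurable_lpLIntegral_right (p := 4)
    (f := fun w z => ‖endFactor (fun x y => (cauchyFactor 0 y x)⁻¹) (p 0) w z‖ₑ)
    (measurable_endFactor (κ := fun x y => (cauchyFactor 0 y x)⁻¹) k0 (hp 0)).enorm
  have m1 := measurable_lpLIntegral_right (p := 4)
    (f := fun w z => ‖endFactor (fun x y => (cauchyFactor (2 * l + 1) x y)⁻¹)
      (p (Fin.last _)) w z‖ₑ)
    (measurable_endFactor (κ := fun x y => (cauchyFactor (2 * l + 1) x y)⁻¹) k1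
      (hp (Fin.last _))).enorm
  have b0 := lpLIntegral_endFactor_le (κ := fun x y => (cauchyFactor 0 y x)⁻¹) k0 h0 (hp 0)
  have b1 := lpLIntegral_endFactor_le (κ := fun x y => (cauchyFactor (2 * l + 1) x y)⁻¹) k1 h1
    (hp (Fin.last _))
  set H0 : ℂ → ℝ≥0∞ := fun z => lpLIntegral 4 fun w =>
    ‖endFactor (fun x y => (cauchyFactor 0 y x)⁻¹) (p 0) w z‖ₑ
  set H1 : ℂ → ℝ≥0∞ := fun z => lpLIntegral 4 fun w =>
    ‖endFactor (fun x y => (cauchyFactor (2 * l + 1) x y)⁻¹) (p (Fin.last _)) w z‖ₑ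
  set K := ENNReal.ofReal (hlsConst (1 / 2))
  set P := ∏ i : Fin (2 * l + 1), lpLIntegral 2 fun y => ‖p i.castSucc.succ y‖ₑ with hP
  have hpt : ∀ z, ‖∫ x, chainIntegrand p z x‖ₑ ≤ K ^ (2 * l) * P * (H0 z * H1 z) := fun z =>
    (enorm_integral_chainIntegrand_le hp z).trans_eq (by ring)
  calc _ ≤ lpLIntegral 2 fun z => K ^ (2 * l) * P * (H0 z * H1 z) :=
        lpLIntegral_mono two_pos hpt
    _ = K ^ (2 * l) * P * lpLIntegral 2 fun z => H0 z * H1 z :=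
        lpLIntegral_const_mul two_pos _ (m0.mul m1)
    _ ≤ K ^ (2 * l) * P * (lpLIntegral 4 H0 * lpLIntegral 4 H1) := by
        gcongr
        exact lpLIntegral_mul_le (by norm_num) (by norm_num) (by norm_num) m0 m1
    _ ≤ K ^ (2 * l) * P * ((endConst * lpLIntegral 2 fun y => ‖p 0 y‖ₑ) *
          (endConst * lpLIntegral 2 fun y => ‖p (Fin.last _) y‖ₑ)) := by
        gcongr
    _ = _ := by
        rw [Fin.prod_univ_succ, Fin.prod_univ_castSucc, Fin.succ_last, hP]
        ring

theorem chainIntegrand_one (p : Fin 1 → ℂ → ℂ) (z : ℂ) :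
    chainIntegrand p z =
      (fun y => a1 (-y) z * p 0 y) ∘ MeasurableEquiv.funUnique (Fin 1) ℂ := by
  ext x
  simp [chainIntegrand, cauchyDen, altSum]

theorem lpLIntegral_two_integral_chainIntegrand_one_le {p : Fin 1 → ℂ → ℂ}
    (hp : ∀ i, Measurable (p i)) :
    lpLIntegral 2 (fun z => ‖∫ x, chainIntegrand p z x‖ₑ) ≤
      ENNReal.ofReal Real.pi * ∏ i, lpLIntegral 2 fun y => ‖p i y‖ₑ := by
  have e : ∀ z, ∫ x, chainIntegrand p z x = ∫ y, a1 (-y) z * p 0 y := fun z => by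
    rw [chainIntegrand_one]
    exact (volume_preserving_funUnique (Fin 1) ℂ).integral_comp'
      fun y => a1 (-y) z * p 0 y
  simp_rw [e, Fin.prod_univ_one]
  exact lpLIntegral_two_integral_a1_le (hp 0).aestronglyMeasurable

theorem exists_lpLIntegral_two_integral_chainIntegrand_le :
    ∃ C : ℝ, 0 < C ∧ ∀ (k : ℕ) (p : Fin (2 * k + 1) → ℂ → ℂ), (∀ i, Measurable (p i)) →
      lpLIntegral 2 (fun z => ‖∫ x, chainIntegrand p z x‖ₑ) ≤
        ENNReal.ofReal (C * hlsConst (1 / 2) ^ (2 * k)) *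
          ∏ i, lpLIntegral 2 fun y => ‖p i y‖ₑ := by
  have hK : 0 < hlsConst (1 / 2) := hlsConst_pos (by norm_num)
  have hE : ENNReal.ofReal endConst.toReal = endConst := ENNReal.ofReal_toReal endConst_ne_top
  set K := hlsConst (1 / 2)
  refine ⟨Real.pi + endConst.toReal ^ 2 / K ^ 2, by positivity, fun k p hp => ?_⟩
  obtain _ | l := k
  · refine (lpLIntegral_two_integral_chainIntegrand_one_le hp).trans ?_
    gcongr
    simp only [mul_zero, pow_zero, mul_one]
    have : 0 ≤ endConst.toReal ^ 2 / K ^ 2 := by positivity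
    linarith
  · refine (lpLIntegral_two_integral_chainIntegrand_le (l := l) hp).trans ?_
    gcongr ?_ * ?_
    · rw [← hE, ← ENNReal.ofReal_pow ENNReal.toReal_nonneg, ← ENNReal.ofReal_pow hK.le,
        ← ENNReal.ofReal_mul (by positivity), hE]
      apply ENNReal.ofReal_le_ofReal
      have h1 : endConst.toReal ^ 2 * K ^ (2 * l) =
          endConst.toReal ^ 2 / K ^ 2 * K ^ (2 * (l + 1)) := by
        field_simp
        ring
      rw [h1]
      gcongr
      linarith [Real.pi_pos]
    · exact le_rfl

theorem lpLIntegral_enorm_schwartzMap_ne_top {p : ℝ} (hp : 0 < p) (f : SchwartzMap ℂ ℂ) :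
    lpLIntegral p (fun x => ‖f x‖ₑ) ≠ ∞ := by
  have h := (f.memLp (ENNReal.ofReal p) volume).eLpNorm_ne_top
  rwa [eLpNorm_eq_lintegral_rpow_enorm_toReal (by simpa using hp) ENNReal.ofReal_ne_top,
    ENNReal.toReal_ofReal hp.le] at h

theorem integrable_chainIntegrand {k : ℕ} (p : Fin (2 * k + 1) → SchwartzMap ℂ ℂ) (z : ℂ) :
    Integrable (chainIntegrand (fun i => ⇑(p i)) z) := by
  have hp : ∀ i, Measurable (p i) := fun i => (p i).continuous.measurable
  obtain _ | l := k
  · have h : Integrable fun y => a1 (-y) z * p 0 y := by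
      refine ((p 0).integrable (μ := volume)).bdd_mul (c := 1) ?_ ?_
      · exact (continuous_a1_uncurry.comp
          (continuous_neg.prodMk continuous_const)).aestronglyMeasurable
      · refine .of_forall fun y => ?_
        rw [← toReal_enorm, enorm_a1_neg, ENNReal.toReal_one]
    refine (congrArg Integrable (chainIntegrand_one (fun i => ⇑(p i)) z)).mpr ?_
    exact ((volume_preserving_funUnique (Fin 1) ℂ).integrable_comp_emb
      (MeasurableEquiv.measurableEmbedding _)).2 h
  · refine ⟨((measurable_chainIntegrand hp).comp
      (measurable_prodMk_left (x := z))).aestronglyMeasurable, ?_⟩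
    refine (lintegral_enorm_chainIntegrand_le (l := l) hp z).trans_lt (lt_top_iff_ne_top.2 ?_)
    have h1 := fun i => lpLIntegral_enorm_schwartzMap_ne_top (p := 4 / 3) (by norm_num) (p i)
    have h2 := fun i => lpLIntegral_enorm_schwartzMap_ne_top (p := 2) (by norm_num) (p i)
    refine ENNReal.mul_ne_top (ENNReal.pow_ne_top ENNReal.ofReal_ne_top) (ENNReal.mul_ne_top
      (ENNReal.mul_ne_top ENNReal.ofReal_ne_top (h1 _)) (ENNReal.mul_ne_top
        (ENNReal.prod_ne_top fun i _ => h2 _)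
        (ENNReal.mul_ne_top ENNReal.ofReal_ne_top (h1 _))))

theorem chainIntegrand_update_sub {n : ℕ} (p : Fin (n + 1) → SchwartzMap ℂ ℂ) (m : Fin (n + 1))
    (f g : SchwartzMap ℂ ℂ) (z : ℂ) (x : Fin (n + 1) → ℂ) :
    chainIntegrand (fun i => ⇑(Function.update p m f i)) z x -
        chainIntegrand (fun i => ⇑(Function.update p m g i)) z x =
      chainIntegrand (fun i => ⇑(Function.update p m (f - g) i)) z x := by
  have h : ∀ r : SchwartzMap ℂ ℂ, ∏ i, Function.update p m r i (x i) =
      r (x m) * ∏ i ∈ Finset.univ.erase m, p i (x i) := fun r => by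
    rw [← Finset.mul_prod_erase _ _ (Finset.mem_univ m), Function.update_self]
    congr 1
    exact Finset.prod_congr rfl fun i hi => by
      rw [Function.update_of_ne (Finset.ne_of_mem_erase hi)]
  simp only [chainIntegrand, h, sub_apply]
  ring

theorem integral_chainIntegrand_update_sub {k : ℕ} (p : Fin (2 * k + 1) → SchwartzMap ℂ ℂ)
    (m : Fin (2 * k + 1)) (f g : SchwartzMap ℂ ℂ) (z : ℂ) :
    (∫ x, chainIntegrand (fun i => ⇑(Function.update p m f i)) z x) -
        ∫ x, chainIntegrand (fun i => ⇑(Function.update p m g i)) z x =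
      ∫ x, chainIntegrand (fun i => ⇑(Function.update p m (f - g) i)) z x := by
  rw [← integral_sub (integrable_chainIntegrand _ z) (integrable_chainIntegrand _ z)]
  simp_rw [chainIntegrand_update_sub]

theorem measurable_integral_chainIntegrand {n : ℕ} {p : Fin (n + 1) → ℂ → ℂ}
    (hp : ∀ i, Measurable (p i)) : Measurable fun z => ∫ x, chainIntegrand p z x :=
  (measurable_chainIntegrand hp).stronglyMeasurable.integral_prod_right'.measurable

theorem hlsConst_half_sq_le : hlsConst (1 / 2) ^ 2 ≤ 2 * Real.pi ^ 2 := by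
  have hpi := Real.pi_gt_three
  have h1 : hlsConst (1 / 2) = 9 / 4 * √Real.pi := by
    have h4 : (4 : ℝ) ^ (-(1 / 2 : ℝ)) = 1 / 2 := by
      rw [show (4 : ℝ) = 2 ^ (2 : ℝ) by norm_num, ← Real.rpow_mul (by norm_num)]
      norm_num [Real.rpow_neg_one]
    rw [hlsConst, h4, show (1 - 1 / 2 : ℝ) = 1 / 2 by norm_num, ← Real.sqrt_eq_rpow]
    ring
  rw [h1, mul_pow, Real.sq_sqrt (by positivity)]
  nlinarith

theorem prod_alternating_le {a b M : ℝ} (ha : 0 ≤ a) (hb : 0 ≤ b) (hM : 0 ≤ M)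
    (hab : a ^ 2 + b ^ 2 ≤ M ^ 2) (s n : ℕ) :
    ∏ i ∈ Finset.range n, (if (s + i) % 2 = 0 then a else b) ≤ √2 * (M / √2) ^ n := by
  have h2 : √2 ^ 2 = 2 := Real.sq_sqrt (by norm_num)
  have h2' : 1 ≤ √2 := Real.one_le_sqrt.2 (by norm_num)
  have haM : a ≤ M := by nlinarith
  have hbM : b ≤ M := by nlinarith
  induction n using Nat.twoStepInduction with
  | zero => simp
  | one =>
    simp only [Finset.range_one, Finset.prod_singleton, pow_one]
    rw [mul_div_cancel₀ _ (by positivity)]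
    split_ifs <;> assumption
  | more n ih _ =>
    have h : (if (s + n) % 2 = 0 then a else b) * (if (s + (n + 1)) % 2 = 0 then a else b) =
        a * b := by
      rcases Nat.mod_two_eq_zero_or_one (s + n) with h | h
      · have h' : (s + (n + 1)) % 2 = 1 := by omega
        simp [h, h']
      · have h' : (s + (n + 1)) % 2 = 0 := by omega
        simp [h, h', mul_comm]
    rw [Finset.prod_range_succ, Finset.prod_range_succ, mul_assoc, h]
    have h3 : √2 * (M / √2) ^ (n + 2) = √2 * (M / √2) ^ n * (M ^ 2 / 2) := by
      rw [pow_add, div_pow M (√2) 2, h2]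
      ring
    rw [h3]
    gcongr
    nlinarith [sq_nonneg (a - b)]

/-- The potential at position `i` of the alternating product, taken from the pair `(a, b)` for
`i < m` and from the pair `(a', b')` for `m ≤ i`. -/
def hybrid {α : Type*} (a b a' b' : α) (m i : ℕ) : α :=
  if i < m then (if i % 2 = 0 then a else b) else (if i % 2 = 0 then a' else b')

theorem hybrid_update_self {α : Type*} (a b a' b' : α) {n : ℕ} (m : Fin n) :
    Function.update (fun i : Fin n => hybrid a b a' b' m i) m (if (m : ℕ) % 2 = 0 then a' else b') =
      fun i : Fin n => hybrid a b a' b' m i := by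
  refine Function.update_eq_iff.2 ⟨?_, fun _ _ => rfl⟩
  simp [hybrid]

theorem hybrid_update_succ {α : Type*} (a b a' b' : α) {n : ℕ} (m : Fin n) :
    Function.update (fun i : Fin n => hybrid a b a' b' m i) m (if (m : ℕ) % 2 = 0 then a else b) =
      fun i : Fin n => hybrid a b a' b' (m + 1) i := by
  refine Function.update_eq_iff.2 ⟨?_, fun i hi => ?_⟩
  · simp [hybrid]
  · have : (i : ℕ) ≠ m := fun h => hi (Fin.ext h)
    have h : (i : ℕ) < m + 1 ↔ (i : ℕ) < m := by omega
    simp [hybrid, h]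

theorem prod_update_hybrid_le {a b a' b' M d : ℝ} (ha : 0 ≤ a) (hb : 0 ≤ b) (ha' : 0 ≤ a')
    (hb' : 0 ≤ b') (hM : 0 ≤ M) (hd : 0 ≤ d) (hab : a ^ 2 + b ^ 2 ≤ M ^ 2)
    (hab' : a' ^ 2 + b' ^ 2 ≤ M ^ 2) {n : ℕ} (m : Fin (n + 1)) :
    ∏ i, Function.update (fun i : Fin (n + 1) => hybrid a b a' b' m i) m d i ≤
      2 * d * (M / √2) ^ n := by
  obtain ⟨m, hm⟩ := m
  obtain ⟨r, rfl⟩ := Nat.exists_eq_add_of_le (Nat.lt_succ_iff.1 hm)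
  have e : ∀ i : Fin (m + r + 1),
      Function.update (fun i : Fin (m + r + 1) => hybrid a b a' b' m i) ⟨m, hm⟩ d i =
        (fun i : ℕ => if i = m then d else hybrid a b a' b' m i) i := fun i => by
    simp [Function.update_apply, Fin.ext_iff]
  have h1 : ∏ i ∈ Finset.range m, (if i = m then d else hybrid a b a' b' m i) =
      ∏ i ∈ Finset.range m, (if (0 + i) % 2 = 0 then a else b) :=
    Finset.prod_congr rfl fun i hi => by
      have := Finset.mem_range.1 hi
      simp [hybrid, this, this.ne]
  have h2 : ∏ i ∈ Finset.range r,
      (if m + 1 + i = m then d else hybrid a b a' b' m (m + 1 + i)) =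
      ∏ i ∈ Finset.range r, (if (m + 1 + i) % 2 = 0 then a' else b') :=
    Finset.prod_congr rfl fun i hi => by
      have h : m + 1 + i ≠ m := by omega
      have h' : ¬ m + 1 + i < m := by omega
      simp [hybrid, h, h']
  have p1 := prod_alternating_le ha hb hM hab 0 m
  have p2 := prod_alternating_le ha' hb' hM hab' (m + 1) r
  simp_rw [e]
  rw [Fin.prod_univ_eq_prod_range (fun i : ℕ => if i = m then d else hybrid a b a' b' m i),
    show m + r + 1 = m + 1 + r by ring, Finset.prod_range_add, Finset.prod_range_succ, h1, h2,
    if_pos rfl]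
  calc _ ≤ √2 * (M / √2) ^ m * d * (√2 * (M / √2) ^ r) := by
        gcongr
    _ = (√2 ^ 2) * d * (M / √2) ^ (m + r) := by ring
    _ = _ := by rw [Real.sq_sqrt (by norm_num)]

theorem map_hybrid {α β : Type*} (F : α → β) (a b a' b' : α) (m i : ℕ) :
    F (hybrid a b a' b' m i) = hybrid (F a) (F b) (F a') (F b') m i := by
  unfold hybrid
  split_ifs <;> rfl

theorem Sk12_eq_integral_chainIntegrand (q1 q2 : SchwartzMap ℂ ℂ) (k : ℕ) (z : ℂ)
    {p : Fin (2 * k + 1) → SchwartzMap ℂ ℂ}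
    (hp : ∀ i, p i = if (i : ℕ) % 2 = 0 then q1 else q2) :
    Sk12 q1 q2 k z = ((Real.pi : ℂ) ^ (2 * k))⁻¹ *
      ∫ x, chainIntegrand (fun i => ⇑(p i)) z x := by
  have h : (fun i => ⇑(p i)) = fun i : Fin (2 * k + 1) =>
      if (i : ℕ) % 2 = 0 then ⇑q1 else ⇑q2 := funext fun i => by
    rw [hp]
    split_ifs <;> rfl
  rw [h]
  rfl

theorem Sk12_sub_Sk12 (q1 q2 q1' q2' : SchwartzMap ℂ ℂ) (k : ℕ) (z : ℂ) :
    Sk12 q1 q2 k z - Sk12 q1' q2' k z = ((Real.pi : ℂ) ^ (2 * k))⁻¹ *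
      ∑ m : Fin (2 * k + 1), ∫ x, chainIntegrand
        (fun i => ⇑(Function.update (fun i : Fin (2 * k + 1) => hybrid q1 q2 q1' q2' m i) m
          ((if (m : ℕ) % 2 = 0 then q1 else q2) - if (m : ℕ) % 2 = 0 then q1' else q2') i)) z x := by
  rw [Sk12_eq_integral_chainIntegrand q1 q2 k z
      (p := fun i => hybrid q1 q2 q1' q2' (2 * k + 1) i) (fun i => by simp [hybrid, i.2]),
    Sk12_eq_integral_chainIntegrand q1' q2' k z
      (p := fun i => hybrid q1 q2 q1' q2' 0 i) (fun i => by simp [hybrid]), ← mul_sub]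
  congr 1
  simp_rw [← integral_chainIntegrand_update_sub, hybrid_update_self, hybrid_update_succ]
  rw [Fin.sum_univ_eq_sum_range (fun m : ℕ =>
      (∫ x, chainIntegrand (fun i : Fin (2 * k + 1) => ⇑(hybrid q1 q2 q1' q2' (m + 1) i)) z x) -
        ∫ x, chainIntegrand (fun i : Fin (2 * k + 1) => ⇑(hybrid q1 q2 q1' q2' m i)) z x),
    Finset.sum_range_sub (fun m : ℕ =>
      ∫ x, chainIntegrand (fun i : Fin (2 * k + 1) => ⇑(hybrid q1 q2 q1' q2' m i)) z x)]

theorem eLpNorm_toReal_le_matrixL2Norm (f g : ℂ → ℂ) (m : ℕ) :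
    (eLpNorm (if m % 2 = 0 then f else g) 2 volume).toReal ≤ matrixL2Norm f g := by
  refine Real.le_sqrt_of_sq_le ?_
  split_ifs <;> nlinarith [sq_nonneg (eLpNorm f 2 volume).toReal,
    sq_nonneg (eLpNorm g 2 volume).toReal]

theorem sq_add_sq_le_of_matrixL2Norm_le {f g : ℂ → ℂ} {M : ℝ} (h : matrixL2Norm f g ≤ M) :
    (eLpNorm f 2 volume).toReal ^ 2 + (eLpNorm g 2 volume).toReal ^ 2 ≤ M ^ 2 :=
  (Real.sqrt_le_left ((Real.sqrt_nonneg _).trans h)).1 h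

theorem exists_eLpNorm_Sk12_sub_le {M : ℝ} (hM : 0 < M) :
    ∃ C : ℝ, 0 < C ∧ ∀ (k : ℕ) (q1 q2 q1' q2' : SchwartzMap ℂ ℂ),
      matrixL2Norm q1 q2 ≤ M → matrixL2Norm q1' q2' ≤ M →
      eLpNorm (fun z => Sk12 q1 q2 k z - Sk12 q1' q2' k z) 2 volume ≤
        ENNReal.ofReal (C * (2 * k + 1) * M ^ (2 * k) *
          matrixL2Norm (fun x => q1 x - q1' x) (fun x => q2 x - q2' x)) := by
  obtain ⟨C, hC, hbound⟩ := exists_lpLIntegral_two_integral_chainIntegrand_le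
  refine ⟨2 * C, by positivity, fun k q1 q2 q1' q2' hq hq' => ?_⟩
  set D := matrixL2Norm (fun x => q1 x - q1' x) (fun x => q2 x - q2' x) with hD
  have hD0 : 0 ≤ D := Real.sqrt_nonneg _
  set K := hlsConst (1 / 2) with hK
  have hK0 : 0 < K := hlsConst_pos (by norm_num)
  have hpi := Real.pi_pos
  let N : SchwartzMap ℂ ℂ → ℝ := fun f => (eLpNorm f 2 volume).toReal
  have hN0 : ∀ f, 0 ≤ N f := fun f => ENNReal.toReal_nonneg
  have hN : ∀ f : SchwartzMap ℂ ℂ, lpLIntegral 2 (fun x => ‖f x‖ₑ) = ENNReal.ofReal (N f) :=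
    fun f => by
      rw [← eLpNorm_two_eq_lpLIntegral, ENNReal.ofReal_toReal (f.memLp 2 volume).eLpNorm_ne_top]
  let δ : Fin (2 * k + 1) → SchwartzMap ℂ ℂ := fun m =>
    (if (m : ℕ) % 2 = 0 then q1 else q2) - if (m : ℕ) % 2 = 0 then q1' else q2'
  have hδ : ∀ m, N (δ m) ≤ D := fun m => by
    have e : ⇑(δ m) = if (m : ℕ) % 2 = 0 then fun x => q1 x - q1' x else fun x => q2 x - q2' x := by
      simp only [δ]
      split_ifs <;> rfl
    simp only [N, e]
    exact eLpNorm_toReal_le_matrixL2Norm _ _ _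
  let P : Fin (2 * k + 1) → Fin (2 * k + 1) → SchwartzMap ℂ ℂ := fun m =>
    Function.update (fun i : Fin (2 * k + 1) => hybrid q1 q2 q1' q2' m i) m (δ m)
  have hP : ∀ m i, Measurable (P m i) := fun m i => (P m i).continuous.measurable
  have hNP : ∀ m, ∏ i, N (P m i) ≤ 2 * D * (M / √2) ^ (2 * k) := fun m => by
    have e : ∀ i, N (P m i) = Function.update
        (fun i : Fin (2 * k + 1) => hybrid (N q1) (N q2) (N q1') (N q2') m i) m (N (δ m)) i :=
      fun i => by
        simp only [P, ← map_hybrid N]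
        exact Function.apply_update (fun _ => N) _ m (δ m) i
    simp_rw [e]
    refine (prod_update_hybrid_le (hN0 q1) (hN0 q2) (hN0 q1') (hN0 q2') hM.le (hN0 _)
      (sq_add_sq_le_of_matrixL2Norm_le hq) (sq_add_sq_le_of_matrixL2Norm_le hq') m).trans ?_
    gcongr
    exact hδ m
  have hconst : (Real.pi ^ (2 * k))⁻¹ * (C * K ^ (2 * k) * (2 * D * (M / √2) ^ (2 * k))) ≤
      2 * C * M ^ (2 * k) * D := by
    have h1 : K ^ 2 / (2 * Real.pi ^ 2) ≤ 1 :=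
      (div_le_one (by positivity)).2 hlsConst_half_sq_le
    have e : (Real.pi ^ (2 * k))⁻¹ * (C * K ^ (2 * k) * (2 * D * (M / √2) ^ (2 * k))) =
        2 * C * M ^ (2 * k) * D * (K ^ 2 / (2 * Real.pi ^ 2)) ^ k := by
      have h2 : √2 ^ (2 * k) = 2 ^ k := by rw [pow_mul, Real.sq_sqrt (by norm_num)]
      rw [div_pow, div_pow, mul_pow, h2, ← pow_mul, ← pow_mul]
      field_simp
    rw [e]
    exact mul_le_of_le_one_right (by positivity) (pow_le_one₀ (by positivity) h1)
  have hterm : ∀ m, eLpNorm (fun z => ∫ x, chainIntegrand (fun i => ⇑(P m i)) z x) 2 volume ≤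
      ENNReal.ofReal (C * K ^ (2 * k) * (2 * D * (M / √2) ^ (2 * k))) := fun m => by
    rw [eLpNorm_two_eq_lpLIntegral]
    refine (hbound k (fun i => ⇑(P m i)) (hP m)).trans ?_
    simp_rw [hN]
    rw [← ENNReal.ofReal_prod_of_nonneg fun i _ => hN0 _, ← ENNReal.ofReal_mul (by positivity)]
    gcongr
    exact hNP m
  have hfun : (fun z => Sk12 q1 q2 k z - Sk12 q1' q2' k z) = ((Real.pi : ℂ) ^ (2 * k))⁻¹ •
      ∑ m, fun z => ∫ x, chainIntegrand (fun i => ⇑(P m i)) z x := by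
    ext z
    rw [Sk12_sub_Sk12, Pi.smul_apply, Finset.sum_apply, smul_eq_mul]
  have hc : ‖((Real.pi : ℂ) ^ (2 * k))⁻¹‖ₑ = ENNReal.ofReal (Real.pi ^ (2 * k))⁻¹ := by
    rw [← ofReal_norm, norm_inv, norm_pow, Complex.norm_of_nonneg hpi.le]
  rw [hfun, eLpNorm_const_smul, hc]
  calc _ ≤ ENNReal.ofReal (Real.pi ^ (2 * k))⁻¹ * ∑ _m : Fin (2 * k + 1),
          ENNReal.ofReal (C * K ^ (2 * k) * (2 * D * (M / √2) ^ (2 * k))) := by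
        gcongr
        refine (eLpNorm_sum_le (fun m _ => (measurable_integral_chainIntegrand
          (hP m)).aestronglyMeasurable) (by norm_num)).trans ?_
        exact Finset.sum_le_sum fun m _ => hterm m
    _ = ENNReal.ofReal ((2 * k + 1) *
          ((Real.pi ^ (2 * k))⁻¹ * (C * K ^ (2 * k) * (2 * D * (M / √2) ^ (2 * k))))) := by
        rw [Finset.sum_const, Finset.card_univ, Fintype.card_fin, nsmul_eq_mul,
          ← ENNReal.ofReal_natCast, ← ENNReal.ofReal_mul (by positivity),
          ← ENNReal.ofReal_mul (by positivity)]
        congr 1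
        push_cast
        ring
    _ ≤ _ := by
        apply ENNReal.ofReal_le_ofReal
        calc _ ≤ (2 * (k : ℝ) + 1) * (2 * C * M ^ (2 * k) * D) := by gcongr
          _ = _ := by ring

end

/-- Lipschitz estimate for each multilinear scattering term: if
`‖Q‖₂ ≤ M` and `‖Q̃‖₂ ≤ M` then
`‖S_k^{12}(Q) − S_k^{12}(Q̃)‖₂ ≤ C_ε (2k+1)(1+ε)^{2k} M^{2k} ‖Q − Q̃‖₂`. -/
theorem scattering_term_lipschitz (M : ℝ) (hM : 0 < M) :
    ∀ ε : ℝ, 0 < ε → ∃ C : ℝ, 0 < C ∧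
      ∀ (k : ℕ) (q1 q2 q1' q2' : SchwartzMap ℂ ℂ),
        matrixL2Norm (⇑q1) (⇑q2) ≤ M → matrixL2Norm (⇑q1') (⇑q2') ≤ M →
        eLpNorm (fun z => Sk12 q1 q2 k z - Sk12 q1' q2' k z) 2 volume
          ≤ ENNReal.ofReal (C * (2 * k + 1) * (1 + ε) ^ (2 * k) * M ^ (2 * k) *
              matrixL2Norm (fun x => q1 x - q1' x) (fun x => q2 x - q2' x)) := by
  intro ε hε
  obtain ⟨C, hC, h⟩ := exists_eLpNorm_Sk12_sub_le hM
  refine ⟨C, hC, fun k q1 q2 q1' q2' hq hq' => (h k q1 q2 q1' q2' hq hq').trans ?_⟩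
  have hD : 0 ≤ matrixL2Norm (fun x => q1 x - q1' x) (fun x => q2 x - q2' x) := Real.sqrt_nonneg _
  have hε' : 1 ≤ (1 + ε) ^ (2 * k) := one_le_pow₀ (by linarith)
  have hC' : 0 ≤ C * (2 * k + 1) := by positivity
  apply ENNReal.ofReal_le_ofReal
  calc _ ≤ (C * (2 * k + 1) * M ^ (2 * k) *
        matrixL2Norm (fun x => q1 x - q1' x) (fun x => q2 x - q2' x)) * (1 + ε) ^ (2 * k) :=
        le_mul_of_one_le_right (by positivity) hε'
    _ = _ := by ring
end
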